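/- arXiv:2111.11273 — 2 statements merged into one kernel-verified Lean document; each statement's English description precedes it below -/
import Mathlib

section
/- Suppose Φ is of type G₂, and let w ∈ W. Then 𝔞_w = ⊕_{α∈Φ(w)} 𝔤_α is a spherical subspace of 𝔫 (i.e. ad(x)⁴ = 0 for every x ∈ 𝔞_w) if and only if w is a commutative element. -/
/- Background setup: a finite reduced crystallographic root system `Φ` with chosen
positive roots `Φ⁺` in a euclidean space `V`, the Cartan pairing, and the basic
combinatorial notions used in the statement. -/

open scoped RealInnerProductSpace

noncomputable section

variable {V : Type*} [NormedAddCommGroup V] [InnerProductSpace ℝ V]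

/-- The Cartan pairing `⟨α, β⟩ = 2 (α, β) / (β, β)`. -/
def cpair (α β : V) : ℝ := 2 * ⟪α, β⟫ / ⟪β, β⟫

/-- The reflection associated to `β`, as a linear endomorphism of `V`:
`v ↦ v - (2 (β, v)/(β, β)) • β`. -/
def reflEnd (β : V) : Module.End ℝ V :=
  LinearMap.id -
    (LinearMap.toSpanSingleton ℝ V β ∘ₗ ((2 / ⟪β, β⟫) • (innerSL ℝ β).toLinearMap))

/-- A subset of `V` is orthogonal if the Cartan pairing of any two distinct
elements vanishes. -/
def OrthogonalSet (S : Set V) : Prop := ∀ γ ∈ S, ∀ γ' ∈ S, γ ≠ γ' → cpair γ γ' = 0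

/-- A finite reduced crystallographic root system in the euclidean space `V`,
together with a choice of positive roots. -/
structure RootSystemData (V : Type*) [NormedAddCommGroup V] [InnerProductSpace ℝ V] where
  /-- the set of roots Φ -/
  roots : Set V
  /-- the set of positive roots Φ⁺ -/
  pos : Set V
  finite : roots.Finite
  ne_zero : ∀ α ∈ roots, α ≠ 0
  span_eq_top : Submodule.span ℝ roots = ⊤
  reduced : ∀ α ∈ roots, ∀ t : ℝ, t • α ∈ roots → t = 1 ∨ t = -1
  crystallographic : ∀ α ∈ roots, ∀ β ∈ roots, ∃ n : ℤ, cpair α β = (n : ℝ)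
  reflect_mem : ∀ α ∈ roots, ∀ β ∈ roots, reflEnd β α ∈ roots
  pos_subset : pos ⊆ roots
  pos_iff : ∀ α ∈ roots, (α ∈ pos ↔ ¬ (-α ∈ pos))
  pos_add : ∀ α ∈ pos, ∀ β ∈ pos, α + β ∈ roots → α + β ∈ pos

namespace RootSystemData

variable (D : RootSystemData V)

/-- Irreducibility: the roots admit no nontrivial partition into two mutually
orthogonal parts. -/
def IsIrreducible : Prop :=
  D.roots.Nonempty ∧
    ∀ s ⊆ D.roots, (∀ α ∈ s, ∀ β ∈ D.roots \ s, ⟪α, β⟫ = 0) → s = ∅ ∨ s = D.roots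

/-- An irreducible root system is not of type `G₂` iff no Cartan pairing of two
roots equals `±3`. -/
def NotG2 : Prop := ∀ α ∈ D.roots, ∀ β ∈ D.roots, cpair α β ≠ 3 ∧ cpair α β ≠ -3

/-- An irreducible root system is of type `G₂` iff some Cartan pairing of two
roots equals `±3`. -/
def IsG2 : Prop :=
  D.IsIrreducible ∧ ∃ α ∈ D.roots, ∃ β ∈ D.roots, cpair α β = 3 ∨ cpair α β = -3

/-- All roots have the same length (types A, D, E). -/
def SimplyLaced : Prop := ∀ α ∈ D.roots, ∀ β ∈ D.roots, ⟪α, α⟫ = ⟪β, β⟫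

/-- There are exactly two root lengths, with squared-length ratio 2
(types B, C, F₄). -/
def DoublyLaced : Prop :=
  (∃ α ∈ D.roots, ∃ β ∈ D.roots, ⟪β, β⟫ = 2 * ⟪α, α⟫) ∧
    ∀ α ∈ D.roots, ∀ β ∈ D.roots,
      ⟪α, α⟫ = ⟪β, β⟫ ∨ ⟪β, β⟫ = 2 * ⟪α, α⟫ ∨ ⟪α, α⟫ = 2 * ⟪β, β⟫

/-- A root of maximal length. -/
def IsLong (α : V) : Prop := α ∈ D.roots ∧ ∀ β ∈ D.roots, ⟪β, β⟫ ≤ ⟪α, α⟫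

/-- A root of minimal length. -/
def IsShort (α : V) : Prop := α ∈ D.roots ∧ ∀ β ∈ D.roots, ⟪α, α⟫ ≤ ⟪β, β⟫

/-- A set of positive roots is convex if any root which is a linear combination of
two of its elements with positive coefficients lies in it. -/
def ConvexSubset (S : Set V) : Prop :=
  ∀ α ∈ S, ∀ β ∈ S, ∀ a b : ℝ, 0 < a → 0 < b →
    a • α + b • β ∈ D.roots → a • α + b • β ∈ S

/-- A subset `Ψ ⊆ Φ⁺` is biconvex if both `Ψ` and `Φ⁺ \ Ψ` are convex. -/
def Biconvex (S : Set V) : Prop :=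
  S ⊆ D.pos ∧ D.ConvexSubset S ∧ D.ConvexSubset (D.pos \ S)

/-- A subset `Ψ ⊆ Φ⁺` is a combinatorial ideal if `α ∈ Ψ`, `β ∈ Φ⁺`, `α + β ∈ Φ⁺`
imply `α + β ∈ Ψ`. -/
def CombIdeal (S : Set V) : Prop :=
  S ⊆ D.pos ∧ ∀ α ∈ S, ∀ β ∈ D.pos, α + β ∈ D.pos → α + β ∈ S

end RootSystemData

/- The Weyl group: words in the simple reflections, reduced expressions, length,
inversion sets, and the (fully) commutative elements. -/

/-- The product of the reflections attached to a word (a list of roots). -/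
def wordProd (l : List V) : Module.End ℝ V := (l.map reflEnd).prod

/-- The alternating word `[α, β, α, β, ...]` of length `n`. -/
def altWord (α β : V) : ℕ → List V
  | 0 => []
  | n + 1 => α :: altWord β α n

namespace RootSystemData

variable (D : RootSystemData V)

/-- The simple roots: the positive roots which are not sums of two positive
roots. -/
def simpleRoots : Set V :=
  {α | α ∈ D.pos ∧ ¬ ∃ β ∈ D.pos, ∃ γ ∈ D.pos, α = β + γ}

/-- A word in the simple reflections, encoded as a list of simple roots. -/
def IsWord (l : List V) : Prop := ∀ α ∈ l, α ∈ D.simpleRoots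

/-- Membership in the Weyl group: `w` is a product of simple reflections. -/
def InWeyl (w : Module.End ℝ V) : Prop := ∃ l : List V, D.IsWord l ∧ wordProd l = w

/-- A reduced word: a word of minimal length among all words with the same
product. -/
def IsReducedWord (l : List V) : Prop :=
  D.IsWord l ∧
    ∀ l' : List V, D.IsWord l' → wordProd l' = wordProd l → l.length ≤ l'.length

/-- The length of a Weyl group element. -/
noncomputable def len (w : Module.End ℝ V) : ℕ :=
  sInf {n | ∃ l : List V, D.IsWord l ∧ wordProd l = w ∧ l.length = n}

/-- The inversion set `Φ(w) = {α ∈ Φ⁺ | w(α) ∈ Φ⁻}`. -/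
def inversions (w : Module.End ℝ V) : Set V :=
  {α | α ∈ D.pos ∧ w α ∈ D.roots ∧ w α ∉ D.pos}

/-- `w` is fully commutative: no reduced expression for `w` contains a contiguous
substring `s_α s_β s_α s_β ⋯` of length `m(s_α, s_β)`, where `s_α, s_β` are
non-commuting simple reflections and `m(s_α, s_β)` is the order of `s_α s_β`. -/
def FullyCommutative (w : Module.End ℝ V) : Prop :=
  D.InWeyl w ∧
    ∀ l : List V, D.IsReducedWord l → wordProd l = w →
      ∀ α ∈ D.simpleRoots, ∀ β ∈ D.simpleRoots,
        ¬ Commute (reflEnd α) (reflEnd β) →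
          ¬ (altWord α β (orderOf (reflEnd α * reflEnd β)) <:+: l)

/-- `w` is commutative: no reduced expression for `w` contains a substring
`s_α s_β s_α` with `α, β` simple and `‖α‖ ≤ ‖β‖`. -/
def Commutative (w : Module.End ℝ V) : Prop :=
  D.InWeyl w ∧
    ∀ l : List V, D.IsReducedWord l → wordProd l = w →
      ∀ α ∈ D.simpleRoots, ∀ β ∈ D.simpleRoots, ‖α‖ ≤ ‖β‖ →
        ¬ ([α, β, α] <:+: l)

end RootSystemData

/- The Lie-theoretic setup: a finite-dimensional complex simple Lie algebra `𝔤`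
with Cartan subalgebra `𝔱`, whose root space decomposition is indexed by the
root system `Φ ⊆ V`. -/

/-- A finite-dimensional simple complex Lie algebra `L`, together with a Cartan
subalgebra and its root space decomposition, whose root system is `Φ ⊆ V` with a
choice of positive roots (determining the Borel subalgebra `𝔟 = 𝔱 ⊕ 𝔫`). -/
structure LieRootData (V : Type*) [NormedAddCommGroup V] [InnerProductSpace ℝ V]
    (L : Type*) [LieRing L] [LieAlgebra ℂ L] extends RootSystemData V where
  /-- the Cartan subalgebra 𝔱 -/
  cartan : LieSubalgebra ℂ L
  /-- the root space 𝔤_α attached to each root α -/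
  rs : V → Submodule ℂ L
  finiteDim : FiniteDimensional ℂ L
  isSimple : LieAlgebra.IsSimple ℂ L
  isCartan : cartan.IsCartanSubalgebra
  rs_dim : ∀ α ∈ roots, Module.finrank ℂ (rs α) = 1
  sup_eq_top : cartan.toSubmodule ⊔ (⨆ α ∈ roots, rs α) = ⊤
  indep : ∀ α ∈ roots, rs α ⊓ (cartan.toSubmodule ⊔ ⨆ β ∈ roots \ {α}, rs β) = ⊥
  weight_vec : ∀ α ∈ roots, ∀ h ∈ cartan, ∀ x ∈ rs α, ∃ c : ℂ, ⁅h, x⁆ = c • x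
  bracket_mem : ∀ α ∈ roots, ∀ β ∈ roots, α + β ∈ roots →
    ∀ x ∈ rs α, ∀ y ∈ rs β, ⁅x, y⁆ ∈ rs (α + β)
  bracket_ne_zero : ∀ α ∈ roots, ∀ β ∈ roots, α + β ∈ roots →
    ∀ x ∈ rs α, x ≠ 0 → ∀ y ∈ rs β, y ≠ 0 → ⁅x, y⁆ ≠ 0
  bracket_eq_zero : ∀ α ∈ roots, ∀ β ∈ roots, α + β ∉ roots → α + β ≠ 0 →
    ∀ x ∈ rs α, ∀ y ∈ rs β, ⁅x, y⁆ = 0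
  bracket_cartan_mem : ∀ α ∈ roots, ∀ x ∈ rs α, ∀ y ∈ rs (-α), ⁅x, y⁆ ∈ cartan

namespace LieRootData

variable {L : Type*} [LieRing L] [LieAlgebra ℂ L] (D : LieRootData V L)

/-- The nilradical `𝔫 = ⊕_{α ∈ Φ⁺} 𝔤_α` of the Borel subalgebra, as a submodule. -/
def nilrad : Submodule ℂ L := ⨆ α ∈ D.pos, D.rs α

/-- The Borel subalgebra `𝔟 = 𝔱 ⊕ 𝔫`, as a submodule. -/
def borel : Submodule ℂ L := D.cartan.toSubmodule ⊔ D.nilrad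

/-- The subspace `𝔞_Ψ = ⊕_{α ∈ Ψ} 𝔤_α` attached to a subset `Ψ ⊆ Φ⁺`. -/
def aSubspace (S : Set V) : Submodule ℂ L := ⨆ α ∈ S, D.rs α

end LieRootData

/-- A subspace of `𝔫` is spherical if `ad(x)^4 = 0` for every `x` in it. -/
def IsSphericalSubspace {L : Type*} [LieRing L] [LieAlgebra ℂ L]
    (a : Submodule ℂ L) : Prop :=
  ∀ x ∈ a, (LieAlgebra.ad ℂ L x) ^ 4 = 0

/-- The height of a nilpotent element `x`: `max {n | ad(x)^n ≠ 0}`. -/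
noncomputable def heightOf {L : Type*} [LieRing L] [LieAlgebra ℂ L] (x : L) : ℕ :=
  sSup {n : ℕ | (LieAlgebra.ad ℂ L x) ^ n ≠ 0}


open scoped RealInnerProductSpace

/-- Integer combination `c.1 a + c.2 b`. -/
def vec (a b : V) (c : ℤ × ℤ) : V := (c.1 : ℝ) • a + (c.2 : ℝ) • b

/-- The coordinates of the positive roots of `G₂`. -/
def P6 : List (ℤ × ℤ) := [(1,0),(0,1),(1,1),(2,1),(3,1),(3,2)]

/-- The coordinates of all roots of `G₂`. -/
def R12 : List (ℤ × ℤ) :=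
  [(1,0),(0,1),(1,1),(2,1),(3,1),(3,2),(-1,0),(0,-1),(-1,-1),(-2,-1),(-3,-1),(-3,-2)]

lemma vec_add (a b : V) (c d : ℤ × ℤ) : vec a b c + vec a b d = vec a b (c + d) := by
  simp only [vec, Prod.fst_add, Prod.snd_add]; push_cast; module

lemma vec_neg (a b : V) (c : ℤ × ℤ) : - vec a b c = vec a b (-c) := by
  simp only [vec, Prod.fst_neg, Prod.snd_neg]; push_cast; module

lemma reflEnd_apply (β v : V) : reflEnd β v = v - (2 * ⟪β, v⟫ / ⟪β, β⟫) • β := by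
  simp [reflEnd]
  congr 1
  ring

/-- A pair consisting of a short and a long root at angle 150 degrees. -/
structure GPair (D : RootSystemData V) (a b : V) : Prop where
  ha : a ∈ D.roots
  hb : b ∈ D.roots
  hab : 2 * ⟪a, b⟫ = -3 * ⟪a, a⟫
  hbb : ⟪b, b⟫ = 3 * ⟪a, a⟫

variable {D : RootSystemData V} {a b : V}

namespace GPair

lemma pos (h : GPair D a b) : 0 < ⟪a, a⟫ := by
  have := D.ne_zero a h.ha
  exact real_inner_self_pos.mpr this

lemma refl_a (h : GPair D a b) (x y : ℤ) : reflEnd a (vec a b (x,y)) = vec a b (-x+3*y, y) := by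
  have hp := h.pos
  have : 2 * ⟪a, vec a b (x,y)⟫ / ⟪a, a⟫ = 2*x-3*y := by
    rw [div_eq_iff hp.ne']
    simp only [vec, inner_add_right, inner_smul_right]
    linear_combination (y:ℝ) * h.hab
  rw [reflEnd_apply, this]
  simp only [vec]; push_cast; module

lemma refl_b (h : GPair D a b) (x y : ℤ) : reflEnd b (vec a b (x,y)) = vec a b (x, x-y) := by
  have hp := h.pos
  have hb := h.hbb
  have : 2 * ⟪b, vec a b (x,y)⟫ / ⟪b, b⟫ = 2*y-x := by
    rw [div_eq_iff (by rw [hb]; positivity)]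
    simp only [vec, inner_add_right, inner_smul_right]
    rw [real_inner_comm]
    linear_combination (x:ℝ) * h.hab + (x:ℝ) * hb
  rw [reflEnd_apply, this]
  simp only [vec]; push_cast; module

lemma veca (a b : V) : vec a b (1,0) = a := by simp [vec]
lemma vecb (a b : V) : vec a b (0,1) = b := by simp [vec]

lemma mem_ra (h : GPair D a b) {x y : ℤ} (m : vec a b (x,y) ∈ D.roots) :
    vec a b (-x+3*y, y) ∈ D.roots := by
  rw [← h.refl_a]; exact D.reflect_mem _ m _ h.ha

lemma mem_rb (h : GPair D a b) {x y : ℤ} (m : vec a b (x,y) ∈ D.roots) :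
    vec a b (x, x-y) ∈ D.roots := by
  rw [← h.refl_b]; exact D.reflect_mem _ m _ h.hb

lemma mem_of_R12 (h : GPair D a b) {c : ℤ × ℤ} (hc : c ∈ R12) : vec a b c ∈ D.roots := by
  have h1 : vec a b (1,0) ∈ D.roots := by rw [veca]; exact h.ha
  have h2 : vec a b (0,1) ∈ D.roots := by rw [vecb]; exact h.hb
  have h3 := h.mem_rb h1
  have h4 := h.mem_ra h3
  have h5 := h.mem_ra h2
  have h6 := h.mem_rb h5
  have n1 := h.mem_ra h1
  have n2 := h.mem_rb h2
  have n3 := h.mem_rb n1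
  have n4 := h.mem_ra n3
  have n5 := h.mem_ra n2
  have n6 := h.mem_rb n5
  norm_num at h1 h2 h3 h4 h5 h6 n1 n2 n3 n4 n5 n6
  simp only [R12, List.mem_cons, List.not_mem_nil, or_false] at hc
  rcases hc with rfl | rfl | rfl | rfl | rfl | rfl | rfl | rfl | rfl | rfl | rfl | rfl <;> assumption

lemma inj (h : GPair D a b) {x y : ℝ} (e : x • a + y • b = 0) : x = 0 ∧ y = 0 := by
  have hp := h.pos
  have e1 : ⟪a, x • a + y • b⟫ = 0 := by rw [e]; simp
  have e2 : ⟪b, x • a + y • b⟫ = 0 := by rw [e]; simp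
  simp only [inner_add_right, inner_smul_right] at e1 e2
  rw [real_inner_comm] at e2
  have hab := h.hab
  have hbb := h.hbb
  have hab' : ⟪a, b⟫ = -3/2 * ⟪a, a⟫ := by linarith
  rw [hab'] at e1 e2
  rw [hbb] at e2
  have f1 : (x - 3/2*y) * ⟪a, a⟫ = 0 := by linarith
  have f2 : (-3/2*x+3*y) * ⟪a, a⟫ = 0 := by linarith
  have g1 := (mul_eq_zero.mp f1).resolve_right hp.ne'
  have g2 := (mul_eq_zero.mp f2).resolve_right hp.ne'
  constructor <;> linarith

lemma vec_inj (h : GPair D a b) {c d : ℤ × ℤ} (e : vec a b c = vec a b d) : c = d := by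
  have : ((c.1:ℝ) - d.1) • a + ((c.2:ℝ) - d.2) • b = 0 := by
    have := sub_eq_zero.mpr e
    rw [← this]; simp only [vec]; module
  obtain ⟨h1, h2⟩ := h.inj this
  ext
  · exact_mod_cast sub_eq_zero.mp h1
  · exact_mod_cast sub_eq_zero.mp h2

lemma arith (m n k l : ℤ) (h0 : ¬ (m = 0 ∧ n = 0)) (r : ℝ) (hk : k * r = m) (hl : l * r = 3 * n)
    (hQ : ((m^2+3*m*n+3*n^2 : ℤ) : ℝ) ≤ r) :
    ((m^2+3*m*n+3*n^2 : ℤ) : ℝ) = r ∧ (2*m+3*n, m+2*n) ∈ R12 := by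
  obtain ⟨Q, hQd⟩ : ∃ Q : ℤ, Q = m^2+3*m*n+3*n^2 := ⟨_, rfl⟩
  rw [← hQd] at hQ ⊢
  have hQ1 : 1 ≤ Q := by
    by_contra hc
    have : Q ≤ 0 := by omega
    have h4 : (2*m+3*n)^2 + 3*n^2 ≤ 0 := by nlinarith
    have hn : n = 0 := by nlinarith [sq_nonneg (2*m+3*n), sq_nonneg n]
    subst hn
    have hm : m = 0 := by nlinarith
    exact h0 ⟨hm, rfl⟩
  have hQ1' : (1:ℝ) ≤ Q := by exact_mod_cast hQ1
  have hr : 0 < r := by linarith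
  have hmk : Q * |k| ≤ |m| := by
    have : (Q:ℝ) * |(k:ℝ)| ≤ |(m:ℝ)| := by
      rw [← hk, abs_mul, abs_of_pos hr, mul_comm]
      exact mul_le_mul_of_nonneg_left hQ (abs_nonneg _)
    exact_mod_cast this
  have hnl : Q * |l| ≤ |3 * n| := by
    have : (Q:ℝ) * |(l:ℝ)| ≤ |(3:ℝ)*n| := by
      rw [← hl, abs_mul, abs_of_pos hr, mul_comm]
      exact mul_le_mul_of_nonneg_left hQ (abs_nonneg _)
    exact_mod_cast this
  have hx : 3 * n * k = l * m := by
    have : (3 * n * k : ℝ) = l * m := by rw [← hl, ← hk]; ring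
    exact_mod_cast this
  have hk0 : k = 0 → m = 0 := by
    rintro rfl; simp at hk; exact_mod_cast hk.symm
  have hl0 : l = 0 → n = 0 := by
    rintro rfl; simp at hl; exact_mod_cast hl
  have hs1 : 0 ≤ k * m := by
    have : (0:ℝ) ≤ k * m := by rw [← hk]; nlinarith [mul_nonneg (sq_nonneg (k:ℝ)) hr.le]
    exact_mod_cast this
  have hs2 : 0 ≤ l * (3 * n) := by
    have : (0:ℝ) ≤ l * (3 * n) := by rw [← hl]; nlinarith [mul_nonneg (sq_nonneg (l:ℝ)) hr.le]
    exact_mod_cast this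
  have hQm : m ≠ 0 → Q ≤ |m| := by
    intro hm
    have : 1 ≤ |k| := Int.one_le_abs (fun h => hm (hk0 h))
    nlinarith
  have hQn : n ≠ 0 → Q ≤ |3*n| := by
    intro hm
    have : 1 ≤ |l| := Int.one_le_abs (fun h => hm (hl0 h))
    nlinarith
  have hb : |m| ≤ 4 ∧ |n| ≤ 2 := by
    have i1 : m^2 ≤ 4 * Q := by nlinarith [sq_nonneg (m+2*n)]
    have i2 : 3*n^2 ≤ 4 * Q := by nlinarith [sq_nonneg (2*m+3*n)]
    have hm4 : |m| ≤ 4 := by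
      by_cases hm : m = 0
      · subst hm; simp
      · have := hQm hm
        have h3 := sq_abs m
        have := abs_pos.mpr hm
        nlinarith
    refine ⟨hm4, ?_⟩
    by_cases hn : n = 0
    · subst hn; simp
    · by_cases hm : m = 0
      · subst hm
        have := hQn hn
        rw [abs_mul, abs_of_pos (by norm_num : (0:ℤ) < 3)] at this
        have h3 := sq_abs n
        have h5 := abs_pos.mpr hn
        nlinarith
      · have := hQm hm
        have h3 := sq_abs n
        have := abs_nonneg n
        nlinarith
  have key : Q * k = m ∧ Q * l = 3 * n ∧ (2*m+3*n, m+2*n) ∈ R12 := by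
    obtain ⟨hm, hn⟩ := hb
    rw [abs_le] at hm hn
    obtain ⟨hm1, hm2⟩ := hm
    obtain ⟨hn1, hn2⟩ := hn
    rw [abs_eq_max_neg, abs_eq_max_neg] at hmk hnl
    clear hk hl hQ hQ1' hr hQm hQn
    interval_cases m <;> interval_cases n <;> norm_num at hQd <;> subst hQd <;>
      first
      | (exfalso; omega)
      | (refine ⟨?_, ?_, by decide⟩ <;> omega)
  refine ⟨?_, key.2.2⟩
  obtain ⟨k1, k2, -⟩ := key
  by_cases hm : m = 0
  · have hn : n ≠ 0 := fun h => h0 ⟨hm, h⟩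
    have hl1 : l ≠ 0 := fun h => by subst h; omega
    have : (l:ℝ) ≠ 0 := by exact_mod_cast hl1
    apply mul_left_cancel₀ this
    rw [hl]; rw [mul_comm]; exact_mod_cast k2
  · have hl1 : k ≠ 0 := fun h => hm (hk0 h)
    have : (k:ℝ) ≠ 0 := by exact_mod_cast hl1
    apply mul_left_cancel₀ this
    rw [hk]; rw [mul_comm]; exact_mod_cast k1

lemma orth_or_mem (h : GPair D a b) {δ : V} (hδ : δ ∈ D.roots) :
    (⟪δ, a⟫ = 0 ∧ ⟪δ, b⟫ = 0) ∨ ∃ c ∈ R12, δ = vec a b c := by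
  have hp := h.pos
  have hab := h.hab
  have hbb := h.hbb
  have hg : 0 < ⟪δ, δ⟫ := real_inner_self_pos.mpr (D.ne_zero _ hδ)
  obtain ⟨m, hm⟩ := D.crystallographic δ hδ a h.ha
  obtain ⟨n, hn⟩ := D.crystallographic δ hδ b h.hb
  obtain ⟨k, hk⟩ := D.crystallographic a h.ha δ hδ
  obtain ⟨l, hl⟩ := D.crystallographic b h.hb δ hδ
  simp only [cpair] at hm hn hk hl
  rw [div_eq_iff (by positivity)] at hm hk hl
  rw [hbb, div_eq_iff (by positivity)] at hn
  rw [real_inner_comm] at hk hl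
  by_cases h0 : m = 0 ∧ n = 0
  · left
    obtain ⟨rfl, rfl⟩ := h0
    simp at hm hn
    exact ⟨hm, hn⟩
  right
  have hnorm : ⟪δ - vec a b (2*m+3*n, m+2*n), δ - vec a b (2*m+3*n, m+2*n)⟫
      = ⟪δ, δ⟫ - (m^2+3*m*n+3*n^2) * ⟪a, a⟫ := by
    simp only [vec, inner_sub_left, inner_sub_right, inner_add_left, inner_add_right,
      inner_smul_left, inner_smul_right]
    rw [real_inner_comm δ a, real_inner_comm δ b, real_inner_comm a b, hbb]
    have e1 : ⟪δ, a⟫ = m * ⟪a, a⟫ / 2 := by linarith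
    have e2 : ⟪δ, b⟫ = 3 * n * ⟪a, a⟫ / 2 := by linarith
    have e3 : ⟪a, b⟫ = -3 / 2 * ⟪a, a⟫ := by linarith
    simp only [e1, e2, e3]
    simp
    ring
  have hge : (0:ℝ) ≤ ⟪δ, δ⟫ - (m^2+3*m*n+3*n^2) * ⟪a, a⟫ := by
    rw [← hnorm]; exact real_inner_self_nonneg
  obtain ⟨hQ, hR⟩ := arith m n k l h0 (⟪δ, δ⟫ / ⟪a, a⟫)
    (by field_simp; linarith) (by field_simp; linarith)
    (by rw [le_div_iff₀ hp]; push_cast; linarith)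
  refine ⟨_, hR, ?_⟩
  rw [eq_div_iff hp.ne'] at hQ
  push_cast at hQ
  rw [hQ, sub_self] at hnorm
  exact sub_eq_zero.mp (inner_self_eq_zero.mp hnorm)

lemma mem_iff (h : GPair D a b) (hI : D.IsIrreducible) {δ : V} :
    δ ∈ D.roots ↔ ∃ c ∈ R12, δ = vec a b c := by
  constructor
  · intro hδ
    have := hI.2 {v | ∃ c ∈ R12, v = vec a b c} (by
      rintro _ ⟨c, hc, rfl⟩; exact h.mem_of_R12 hc) (by
      rintro _ ⟨c, hc, rfl⟩ β ⟨hβ, hβ'⟩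
      rcases h.orth_or_mem hβ with ⟨h1, h2⟩ | h3
      · simp only [vec, inner_add_left, inner_smul_left]
        rw [real_inner_comm β a, real_inner_comm β b, h1, h2]; simp
      · exact absurd h3 hβ')
    rcases this with h1 | h1
    · exfalso
      have : a ∈ ({v | ∃ c ∈ R12, v = vec a b c} : Set V) := ⟨(1,0), by decide, (veca a b).symm⟩
      rw [h1] at this; exact this
    · rw [← h1] at hδ; exact hδ
  · rintro ⟨c, hc, rfl⟩; exact h.mem_of_R12 hc

lemma vec_mem_iff (h : GPair D a b) (hI : D.IsIrreducible) {c : ℤ × ℤ} :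
    vec a b c ∈ D.roots ↔ c ∈ R12 := by
  rw [h.mem_iff hI]
  constructor
  · rintro ⟨d, hd, e⟩; rw [h.vec_inj e]; exact hd
  · intro hc; exact ⟨c, hc, rfl⟩

/-- Twice the Gram form on coordinates, in units of the square of the short root. -/
def qf (c d : ℤ × ℤ) : ℤ := 2*c.1*d.1 - 3*(c.1*d.2+c.2*d.1) + 6*c.2*d.2

lemma inner_vec (h : GPair D a b) (c d : ℤ × ℤ) :
    2 * ⟪vec a b c, vec a b d⟫ = qf c d * ⟪a, a⟫ := by
  simp only [vec, qf, inner_add_left, inner_add_right, inner_smul_left, inner_smul_right]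
  rw [real_inner_comm a b, h.hbb]
  push_cast
  simp only [conj_trivial]
  linear_combination ((c.1:ℝ) * d.2 + c.2 * d.1) * h.hab

lemma conj (h : GPair D a b) (c d : ℤ × ℤ) (hc : c ∈ R12) (hd : d ∈ R12)
    (h1 : 2 * qf c d = -3 * qf c c) (h2 : qf d d = 3 * qf c c) :
    GPair D (vec a b c) (vec a b d) := by
  refine ⟨h.mem_of_R12 hc, h.mem_of_R12 hd, ?_, ?_⟩
  · have h1' : (2 * qf c d : ℝ) = -3 * qf c c := by exact_mod_cast h1
    have e1 := h.inner_vec c d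
    have e2 := h.inner_vec c c
    linear_combination e1 - (-3/2) * e2 + h1' * ⟪a, a⟫ / 2
  · have h2' : (qf d d : ℝ) = 3 * qf c c := by exact_mod_cast h2
    have e1 := h.inner_vec d d
    have e2 := h.inner_vec c c
    linear_combination e1 / 2 - 3 / 2 * e2 + h2' * ⟪a, a⟫ / 2

end GPair

lemma neg_mem {α : V} (h : α ∈ D.roots) : -α ∈ D.roots := by
  have := D.reflect_mem α h α h
  rw [reflEnd_apply] at this
  have h0 : ⟪α, α⟫ ≠ 0 := (real_inner_self_pos.mpr (D.ne_zero _ h)).ne'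
  rw [mul_div_assoc, div_self h0] at this
  convert this using 1
  module

lemma exists_gpair (hG : D.IsG2) : ∃ a b, GPair D a b := by
  obtain ⟨hI, α, hα, β, hβ, h⟩ := hG
  have hp : 0 < ⟪β, β⟫ := real_inner_self_pos.mpr (D.ne_zero _ hβ)
  obtain ⟨b, hb, hc⟩ : ∃ b ∈ D.roots, 2 * ⟪β, b⟫ = -3 * ⟪β, β⟫ := by
    simp only [cpair] at h
    rw [div_eq_iff hp.ne', div_eq_iff hp.ne', real_inner_comm] at h
    rcases h with h | h
    · exact ⟨-α, neg_mem hα, by rw [inner_neg_right]; linarith⟩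
    · exact ⟨α, hα, h⟩
  refine ⟨β, b, hβ, hb, hc, ?_⟩
  have hpb : 0 < ⟪b, b⟫ := real_inner_self_pos.mpr (D.ne_zero _ hb)
  obtain ⟨n, hn⟩ := D.crystallographic β hβ b hb
  simp only [cpair] at hn
  rw [div_eq_iff hpb.ne', hc] at hn
  have cs := real_inner_mul_inner_self_le β b
  have hbc : ⟪β, b⟫ = -3/2*⟪β, β⟫ := by linarith
  rw [hbc] at cs
  have cs2 : 9/4 * ⟪β, β⟫ ≤ ⟪b, b⟫ := by
    by_contra hlt
    nlinarith
  have n1 : n < 0 := by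
    have : (n:ℝ) < 0 := by nlinarith
    exact_mod_cast this
  have n2 : -2 < n := by
    have : (-2:ℝ) < n := by nlinarith
    exact_mod_cast this
  have : n = -1 := by omega
  subst this
  push_cast at hn
  linarith

/-- A `GPair` consisting of positive roots. -/
lemma exists_pos_gpair (hG : D.IsG2) : ∃ a b, GPair D a b ∧ a ∈ D.pos ∧ b ∈ D.pos := by
  obtain ⟨a, b, h⟩ := exists_gpair hG
  by_contra hcon
  have hc : ∀ c d : ℤ × ℤ, c ∈ R12 → d ∈ R12 → 2 * GPair.qf c d = -3 * GPair.qf c c →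
      GPair.qf d d = 3 * GPair.qf c c → ¬ (vec a b c ∈ D.pos ∧ vec a b d ∈ D.pos) :=
    fun c d h1 h2 h3 h4 hp => hcon ⟨_, _, h.conj c d h1 h2 h3 h4, hp⟩
  have hn : ∀ c ∈ R12, (vec a b c ∈ D.pos ↔ ¬ vec a b (-c) ∈ D.pos) := by
    intro c hc
    rw [← vec_neg]
    exact D.pos_iff _ (h.mem_of_R12 hc)
  have a1 := hc (1,0) (0,1) (by decide) (by decide) (by decide) (by decide)
  have a2 := hc (-1,0) (3,1) (by decide) (by decide) (by decide) (by decide)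
  have a3 := hc (2,1) (-3,-1) (by decide) (by decide) (by decide) (by decide)
  have a4 := hc (-2,-1) (3,2) (by decide) (by decide) (by decide) (by decide)
  have a5 := hc (1,1) (-3,-2) (by decide) (by decide) (by decide) (by decide)
  have a6 := hc (-1,-1) (0,1) (by decide) (by decide) (by decide) (by decide)
  have b1 := hc (-1,0) (0,-1) (by decide) (by decide) (by decide) (by decide)
  have b2 := hc (1,0) (-3,-1) (by decide) (by decide) (by decide) (by decide)
  have b3 := hc (-2,-1) (3,1) (by decide) (by decide) (by decide) (by decide)
  have b4 := hc (2,1) (-3,-2) (by decide) (by decide) (by decide) (by decide)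
  have b5 := hc (-1,-1) (3,2) (by decide) (by decide) (by decide) (by decide)
  have b6 := hc (1,1) (0,-1) (by decide) (by decide) (by decide) (by decide)
  have n1 := hn (1,0) (by decide)
  have n2 := hn (0,1) (by decide)
  have n3 := hn (1,1) (by decide)
  have n4 := hn (2,1) (by decide)
  have n5 := hn (3,1) (by decide)
  have n6 := hn (3,2) (by decide)
  simp only [Prod.neg_mk, neg_zero] at n1 n2 n3 n4 n5 n6
  clear hn hc hcon
  grind

/-- A `GPair` of positive roots in an irreducible system: this pins everything. -/
structure GBase (D : RootSystemData V) (a b : V) : Prop where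
  pair : GPair D a b
  irr : D.IsIrreducible
  pa : a ∈ D.pos
  pb : b ∈ D.pos

namespace GBase

lemma pos_of_P6 (h : GBase D a b) {c : ℤ × ℤ} (hc : c ∈ P6) : vec a b c ∈ D.pos := by
  have key : ∀ c d : ℤ × ℤ, c + d ∈ R12 → vec a b c ∈ D.pos → vec a b d ∈ D.pos →
      vec a b (c + d) ∈ D.pos := by
    intro c d hcd h1 h2
    rw [← vec_add]
    exact D.pos_add _ h1 _ h2 (by rw [vec_add]; exact h.pair.mem_of_R12 hcd)
  have h1 : vec a b (1,0) ∈ D.pos := by rw [GPair.veca]; exact h.pa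
  have h2 : vec a b (0,1) ∈ D.pos := by rw [GPair.vecb]; exact h.pb
  have h3 := key _ _ (by decide) h1 h2
  have h4 := key _ _ (by decide) h1 h3
  have h5 := key _ _ (by decide) h1 h4
  have h6 := key _ _ (by decide) h2 h5
  norm_num at h3 h4 h5 h6
  simp only [P6, List.mem_cons, List.not_mem_nil, or_false] at hc
  rcases hc with rfl | rfl | rfl | rfl | rfl | rfl <;> assumption

lemma pos_iff' (h : GBase D a b) {c : ℤ × ℤ} : vec a b c ∈ D.pos ↔ c ∈ P6 := by
  refine ⟨fun hc => ?_, h.pos_of_P6⟩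
  have hR := (h.pair.vec_mem_iff h.irr).mp (D.pos_subset hc)
  by_contra hn
  have : -c ∈ P6 := by
    have : ∀ c ∈ R12, c ∉ P6 → -c ∈ P6 := by decide
    exact this c hR hn
  have hp := h.pos_of_P6 this
  rw [← vec_neg] at hp
  exact (D.pos_iff _ (D.pos_subset hc)).mp hc hp

lemma mem_pos (h : GBase D a b) {v : V} : v ∈ D.pos ↔ ∃ c ∈ P6, v = vec a b c := by
  constructor
  · intro hv
    obtain ⟨c, hc, rfl⟩ := (h.pair.mem_iff h.irr).mp (D.pos_subset hv)
    exact ⟨c, h.pos_iff'.mp hv, rfl⟩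
  · rintro ⟨c, hc, rfl⟩; exact h.pos_of_P6 hc

lemma simple_iff (h : GBase D a b) {v : V} : v ∈ D.simpleRoots ↔ v = a ∨ v = b := by
  constructor
  · rintro ⟨hv, hs⟩
    obtain ⟨c, hc, rfl⟩ := h.mem_pos.mp hv
    have : ∀ c ∈ P6, c = (1,0) ∨ c = (0,1) ∨ ∃ d ∈ P6, ∃ e ∈ P6, c = d + e := by decide
    rcases this c hc with rfl | rfl | ⟨d, hd, e, he, rfl⟩
    · left; exact GPair.veca a b
    · right; exact GPair.vecb a b
    · exact absurd ⟨_, h.pos_of_P6 hd, _, h.pos_of_P6 he, (vec_add a b d e).symm⟩ hs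
  · have key : ∀ c : ℤ × ℤ, c ∈ P6 → (∀ d ∈ P6, ∀ e ∈ P6, c ≠ d + e) →
        vec a b c ∈ D.simpleRoots := by
      intro c hc hne
      refine ⟨h.pos_of_P6 hc, ?_⟩
      rintro ⟨β, hβ, γ, hγ, e⟩
      obtain ⟨d, hd, rfl⟩ := h.mem_pos.mp hβ
      obtain ⟨f, hf, rfl⟩ := h.mem_pos.mp hγ
      rw [vec_add] at e
      exact hne d hd f hf (h.pair.vec_inj e)
    rintro (rfl | rfl)
    · have := key (1,0) (by decide) (by decide); rwa [GPair.veca] at this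
    · have := key (0,1) (by decide) (by decide); rwa [GPair.vecb] at this

lemma ne (h : GBase D a b) : a ≠ b := by
  intro e
  have h1 := h.pair.hbb
  have h2 := h.pair.pos
  rw [← e] at h1; linarith

/-- letters -/
def let' (a b : V) (t : Bool) : V := if t then a else b

/-- action of a letter on coordinates -/
def actl (t : Bool) (c : ℤ × ℤ) : ℤ × ℤ := if t then (-c.1+3*c.2, c.2) else (c.1, c.1-c.2)

/-- action of a word on coordinates -/
def act : List Bool → ℤ × ℤ → ℤ × ℤ
  | [], c => c
  | t :: l, c => actl t (act l c)

/-- the product of a word in letters -/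
def wp (a b : V) (l : List Bool) : Module.End ℝ V := wordProd (l.map (let' a b))

lemma wp_apply (h : GBase D a b) (l : List Bool) (c : ℤ × ℤ) :
    wp a b l (vec a b c) = vec a b (act l c) := by
  induction l with
  | nil => simp [wp, wordProd, act]
  | cons t l ih =>
    have : wp a b (t :: l) = reflEnd (let' a b t) * wp a b l := by simp [wp, wordProd]
    rw [this, Module.End.mul_apply, ih, act]
    cases t
    · exact h.pair.refl_b _ _
    · exact h.pair.refl_a _ _

lemma wp_eq_iff (h : GBase D a b) (l l' : List Bool) :
    wp a b l = wp a b l' ↔ act l (1,0) = act l' (1,0) ∧ act l (0,1) = act l' (0,1) := by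
  constructor
  · intro e
    constructor <;> apply h.pair.vec_inj <;> rw [← h.wp_apply, ← h.wp_apply, e]
  · rintro ⟨e1, e2⟩
    have f1 : wp a b l a = wp a b l' a := by
      have := h.wp_apply l (1,0)
      rw [e1, ← h.wp_apply, GPair.veca] at this
      exact this
    have f2 : wp a b l b = wp a b l' b := by
      have := h.wp_apply l (0,1)
      rw [e2, ← h.wp_apply, GPair.vecb] at this
      exact this
    apply LinearMap.ext_on D.span_eq_top
    intro v hv
    obtain ⟨c, hc, rfl⟩ := (h.pair.mem_iff h.irr).mp hv
    simp only [vec, map_add, map_smul, f1, f2]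

lemma word_lift (h : GBase D a b) (l : List V) (hl : D.IsWord l) :
    ∃ l' : List Bool, l = l'.map (let' a b) := by
  induction l with
  | nil => exact ⟨[], rfl⟩
  | cons v l ih =>
    obtain ⟨l', e⟩ := ih (fun α hα => hl α (List.mem_cons_of_mem _ hα))
    rcases h.simple_iff.mp (hl v List.mem_cons_self) with rfl | rfl
    · exact ⟨true :: l', by simp [let', ← e]⟩
    · exact ⟨false :: l', by simp [let', ← e]⟩

lemma isWord_map (h : GBase D a b) (l : List Bool) : D.IsWord (l.map (let' a b)) := by
  intro α hα
  obtain ⟨t, -, rfl⟩ := List.mem_map.mp hα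
  rw [h.simple_iff]
  cases t <;> simp [let']

/-- reduced words in the letters -/
def RedB (l : List Bool) : Prop := ∀ l' : List Bool,
  act l' (1,0) = act l (1,0) → act l' (0,1) = act l (0,1) → l.length ≤ l'.length

/-- short elements: the words of commutative elements -/
def short6 : List (List Bool) :=
  [[], [true], [false], [true,false], [false,true], [false,true,false]]

/-- the remaining reduced words -/
def long7 : List (List Bool) :=
  [[true,false,true], [true,false,true,false], [false,true,false,true],
   [true,false,true,false,true], [false,true,false,true,false],
   [true,false,true,false,true,false], [false,true,false,true,false,true]]

lemma red_mem (l : List Bool) (hl : RedB l) : l ∈ short6 ++ long7 := by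
  induction l with
  | nil => decide
  | cons t l ih =>
    have hl' : RedB l := by
      intro l' h1 h2
      have := hl (t :: l') (by simp only [act, h1]) (by simp only [act, h2])
      simpa using this
    have hm := ih hl'
    have key : ∀ t : Bool, ∀ l ∈ short6 ++ long7, (t :: l) ∈ short6 ++ long7 ∨
        ∃ l' ∈ short6 ++ long7, act l' (1,0) = act (t :: l) (1,0) ∧
          act l' (0,1) = act (t :: l) (0,1) ∧ l'.length < (t :: l).length := by decide
    rcases key t l hm with h | ⟨l', -, h1, h2, h3⟩
    · exact h
    · exact absurd (hl l' h1 h2) (by omega)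

lemma red_lift (h : GBase D a b) {l : List V} (hl : D.IsReducedWord l) :
    ∃ l' ∈ short6 ++ long7, l = l'.map (let' a b) := by
  obtain ⟨l', rfl⟩ := h.word_lift l hl.1
  refine ⟨l', red_mem l' ?_, rfl⟩
  intro m h1 h2
  have := hl.2 (m.map (let' a b)) (h.isWord_map m) ((h.wp_eq_iff m l').mpr ⟨h1, h2⟩)
  simpa using this

lemma exists_red {w : Module.End ℝ V} (hw : D.InWeyl w) :
    ∃ l, D.IsReducedWord l ∧ wordProd l = w := by
  classical
  have hex : ∃ n, ∃ l, D.IsWord l ∧ wordProd l = w ∧ l.length = n := by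
    obtain ⟨l, h1, h2⟩ := hw; exact ⟨_, l, h1, h2, rfl⟩
  obtain ⟨l, h1, h2, h3⟩ := Nat.find_spec hex
  refine ⟨l, ⟨h1, fun l' h4 h5 => ?_⟩, h2⟩
  rw [h3]
  exact Nat.find_min' hex ⟨l', h4, h5.trans h2, rfl⟩

lemma let_inj (h : GBase D a b) : Function.Injective (let' a b) := by
  intro s t e
  cases s <;> cases t <;> simp [let'] at e ⊢
  · exact h.ne e.symm
  · exact h.ne e

/-- commutative elements, explicitly -/
lemma commutative_short (h : GBase D a b) {w : Module.End ℝ V} (hw : D.Commutative w) :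
    ∃ l ∈ short6, wp a b l = w := by
  obtain ⟨l, hl, e⟩ := exists_red hw.1
  obtain ⟨l', hl', rfl⟩ := h.red_lift hl
  rcases List.mem_append.mp hl' with h1 | h1
  · exact ⟨l', h1, e⟩
  · exfalso
    have hn : ‖a‖ ≤ ‖b‖ := by
      have h1 := h.pair.hbb
      have h2 := h.pair.pos
      rw [real_inner_self_eq_norm_sq, real_inner_self_eq_norm_sq] at h1
      nlinarith [norm_nonneg a, norm_nonneg b]
    apply hw.2 _ hl e a (h.simple_iff.mpr (Or.inl rfl)) b (h.simple_iff.mpr (Or.inr rfl)) hn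
    have : ∀ l ∈ long7, [true,false,true] <:+: l := by decide
    have := (this l' h1).map (let' a b)
    simpa [let'] using this

lemma commutative_of_long (h : GBase D a b) {w : Module.End ℝ V} (hw : D.InWeyl w)
    (hno : ∀ l ∈ long7, wp a b l ≠ w) : D.Commutative w := by
  refine ⟨hw, fun l hl e α hα β hβ hn hinf => ?_⟩
  obtain ⟨l', hl', rfl⟩ := h.red_lift hl
  have hs : ∃ t s : Bool, [t,s,t] <:+: l' := by
    obtain ⟨m, hm, e2⟩ := List.infix_map_iff.mp hinf
    have hlen := congrArg List.length e2
    simp only [List.length_map, List.length_cons, List.length_nil] at hlen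
    obtain ⟨x, y, z, rfl⟩ := List.length_eq_three.mp hlen.symm
    simp only [List.map_cons, List.map_nil, List.cons.injEq, and_true] at e2
    have : x = z := h.let_inj (e2.1.symm.trans e2.2.2)
    subst this
    exact ⟨_, _, hm⟩
  rcases List.mem_append.mp hl' with h1 | h1
  · have hl3 : ∀ l ∈ short6, ∀ t s : Bool, [t,s,t] <:+: l → l = [false,true,false] := by decide
    obtain ⟨t, s, hts⟩ := hs
    have := hl3 _ h1 t s hts
    subst this
    have e3 := hinf.eq_of_length (by simp)
    simp [let'] at e3
    obtain ⟨rfl, rfl, -⟩ := e3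
    have h1 := h.pair.hbb
    have h2 := h.pair.pos
    rw [real_inner_self_eq_norm_sq, real_inner_self_eq_norm_sq] at h1
    rw [real_inner_self_eq_norm_sq] at h2
    nlinarith [norm_nonneg α, norm_nonneg β]
  · exact hno l' h1 e

lemma inv_iff (h : GBase D a b) (l : List Bool) (c : ℤ × ℤ) (hc : c ∈ P6) :
    vec a b c ∈ D.inversions (wp a b l) ↔ act l c ∈ R12 ∧ act l c ∉ P6 := by
  simp only [RootSystemData.inversions, Set.mem_ofPred_eq, h.wp_apply, h.pos_iff',
    h.pair.vec_mem_iff h.irr, hc, true_and]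

lemma inv_long (h : GBase D a b) (l : List Bool) (hl : l ∈ long7) :
    (a ∈ D.inversions (wp a b l) ∧ vec a b (2,1) ∈ D.inversions (wp a b l)) ∨
    (vec a b (1,1) ∈ D.inversions (wp a b l) ∧ vec a b (2,1) ∈ D.inversions (wp a b l)) := by
  have e : a ∈ D.inversions (wp a b l) ↔ vec a b (1,0) ∈ D.inversions (wp a b l) := by
    rw [GPair.veca]
  rw [e, h.inv_iff _ _ (by decide), h.inv_iff _ _ (by decide), h.inv_iff _ _ (by decide)]
  clear e
  revert l
  decide

lemma inv_short (h : GBase D a b) (l : List Bool) (hl : l ∈ short6) :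
    ∃ g ∈ P6, GPair.qf g g = 2 ∧ ∀ v ∈ D.inversions (wp a b l), ∃ c ∈ P6, v = vec a b c ∧
      2 ≤ GPair.qf c g := by
  have key : ∀ l ∈ short6, ∃ g ∈ P6, GPair.qf g g = 2 ∧
    ∀ c ∈ P6, (act l c ∈ R12 ∧ act l c ∉ P6) → 2 ≤ GPair.qf c g := by decide
  obtain ⟨g, hg, hg2, hk⟩ := key l hl
  refine ⟨g, hg, hg2, fun v hv => ?_⟩
  obtain ⟨c, hc, rfl⟩ := h.mem_pos.mp hv.1
  exact ⟨c, hc, rfl, hk c hc ((h.inv_iff l c hc).mp hv)⟩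

end GBase

section LiePart

variable {L : Type*} [LieRing L] [LieAlgebra ℂ L]

lemma heis_identity (x y f : L) (aH dH aK dK : ℂ)
    (hxz : ⁅x, ⁅x, y⁆⁆ = 0) (hyz : ⁅y, ⁅x, y⁆⁆ = 0)
    (h1 : ⁅⁅x, ⁅y, f⁆⁆, x⁆ = aH • x) (h2 : ⁅⁅x, ⁅y, f⁆⁆, y⁆ = dH • y)
    (h3 : ⁅⁅y, ⁅x, f⁆⁆, x⁆ = aK • x) (h4 : ⁅⁅y, ⁅x, f⁆⁆, y⁆ = dK • y)
    (e1 : LieAlgebra.ad ℂ L x ^ 4 = 0) (e2 : LieAlgebra.ad ℂ L y ^ 4 = 0)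
    (e3 : LieAlgebra.ad ℂ L (x + y) ^ 4 = 0) (e4 : LieAlgebra.ad ℂ L (x - y) ^ 4 = 0) :
    (aK - dH) • ⁅x, y⁆ = 0 := by
  set X := LieAlgebra.ad ℂ L x with hX
  set Y := LieAlgebra.ad ℂ L y with hY
  rw [map_add] at e3
  rw [map_sub] at e4
  have hS : (2:ℂ) • (X*X*Y*Y + X*Y*X*Y + X*Y*Y*X + Y*X*X*Y + Y*X*Y*X + Y*Y*X*X) = 0 := by
    have : (2:ℂ) • (X*X*Y*Y + X*Y*X*Y + X*Y*Y*X + Y*X*X*Y + Y*X*Y*X + Y*Y*X*X)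
      = (X+Y)^4 + (X-Y)^4 - X^4 - X^4 - Y^4 - Y^4 := by
      rw [two_smul]; noncomm_ring
    rw [this, e1, e2, e3, e4]; simp
  have hS2 := (smul_eq_zero.mp hS).resolve_left two_ne_zero
  have hS3 := LinearMap.congr_fun hS2 f
  simp only [LinearMap.add_apply, Module.End.mul_apply, hX, hY, LieAlgebra.ad_apply,
    LinearMap.zero_apply] at hS3
  have g2 : ∀ c : ℂ, ∀ h u : L, ⁅h, u⁆ = c • u → ⁅u, h⁆ = -(c • u) := by
    intro c h u e; rw [← lie_skew, e]
  have hyx : ⁅y, x⁆ = -⁅x, y⁆ := (lie_skew _ _).symm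
  obtain ⟨H, hH⟩ : ∃ H, H = ⁅x, ⁅y, f⁆⁆ := ⟨_, rfl⟩
  obtain ⟨K, hK⟩ : ∃ K, K = ⁅y, ⁅x, f⁆⁆ := ⟨_, rfl⟩
  rw [← hH] at h1 h2
  rw [← hK] at h3 h4
  have w2 : ⁅x, ⁅y, H⁆⁆ = -(dH • ⁅x, y⁆) := by rw [g2 _ _ _ h2, lie_neg, lie_smul]
  have w3 : ⁅x, ⁅y, K⁆⁆ = -(dK • ⁅x, y⁆) := by rw [g2 _ _ _ h4, lie_neg, lie_smul]
  have w4 : ⁅y, ⁅x, H⁆⁆ = aH • ⁅x, y⁆ := by rw [g2 _ _ _ h1, lie_neg, lie_smul, hyx]; module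
  have w5 : ⁅y, ⁅x, K⁆⁆ = aK • ⁅x, y⁆ := by rw [g2 _ _ _ h3, lie_neg, lie_smul, hyx]; module
  have zH : ⁅⁅x, y⁆, H⁆ = -((aH + dH) • ⁅x, y⁆) := by
    rw [lie_lie, w2, w4]; module
  have zK : ⁅⁅x, y⁆, K⁆ = -((aK + dK) • ⁅x, y⁆) := by
    rw [lie_lie, w3, w5]; module
  have w1 : ⁅x, ⁅x, ⁅y, ⁅y, f⁆⁆⁆⁆ = -((aH + 2 * dH) • ⁅x, y⁆) := by
    have s1 : ⁅x, ⁅y, ⁅y, f⁆⁆⁆ = ⁅⁅x, y⁆, ⁅y, f⁆⁆ + ⁅y, H⁆ := by rw [hH, leibniz_lie]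
    have s2 : ⁅x, ⁅⁅x, y⁆, ⁅y, f⁆⁆⁆ = ⁅⁅x, y⁆, H⁆ := by
      rw [leibniz_lie, hxz, zero_lie, zero_add, hH]
    rw [s1, lie_add, s2, zH, w2]; module
  have w6 : ⁅y, ⁅y, ⁅x, ⁅x, f⁆⁆⁆⁆ = (2 * aK + dK) • ⁅x, y⁆ := by
    have s1 : ⁅y, ⁅x, ⁅x, f⁆⁆⁆ = -⁅⁅x, y⁆, ⁅x, f⁆⁆ + ⁅x, K⁆ := by
      rw [hK, leibniz_lie, hyx, neg_lie]
    have s2 : ⁅y, ⁅⁅x, y⁆, ⁅x, f⁆⁆⁆ = ⁅⁅x, y⁆, K⁆ := by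
      rw [leibniz_lie, hyz, zero_lie, zero_add, hK]
    rw [s1, lie_add, lie_neg, s2, zK, w5]; module
  rw [w1, w6, ← hH, ← hK, w2, w3, w4, w5] at hS3
  have : (3:ℂ) • ((aK - dH) • ⁅x, y⁆) = 0 := by rw [← hS3]; module
  exact (smul_eq_zero.mp this).resolve_left three_ne_zero

lemma qf_bound : ∀ g ∈ P6, GPair.qf g g = 2 →
    ∀ c ∈ R12, -3 ≤ GPair.qf c g ∧ GPair.qf c g ≤ 3 := by
  decide

namespace LieRootData

variable {D : LieRootData V L} {a b : V}

lemma exists_ne (D : LieRootData V L) {α : V} (hα : α ∈ D.roots) : ∃ x ∈ D.rs α, x ≠ 0 := by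
  obtain ⟨v, hv, -⟩ := finrank_eq_one_iff'.mp (D.rs_dim α hα)
  exact ⟨v, v.2, fun h => hv (Subtype.ext h)⟩

lemma exists_wt (D : LieRootData V L) {α : V} (hα : α ∈ D.roots) {h : L} (hh : h ∈ D.cartan) :
    ∃ c : ℂ, ∀ x ∈ D.rs α, ⁅h, x⁆ = c • x := by
  obtain ⟨v, hv, hs⟩ := finrank_eq_one_iff'.mp (D.rs_dim α hα)
  obtain ⟨c, hc⟩ := D.weight_vec α hα h hh v v.2
  refine ⟨c, fun x hx => ?_⟩
  obtain ⟨t, ht⟩ := hs ⟨x, hx⟩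
  have : x = t • (v : L) := by
    have := congrArg Subtype.val ht
    simpa using this.symm
  rw [this, lie_smul, hc, smul_comm]

lemma exists_filtration (g : ℤ × ℤ) : ∃ F : ℤ → Submodule ℂ L,
    (∀ n, n ≤ 0 → ∀ h ∈ D.cartan, h ∈ F n) ∧
    (∀ n, ∀ c ∈ R12, n ≤ GPair.qf c g → D.rs (vec a b c) ≤ F n) ∧
    (∀ n (N : Submodule ℂ L), (n ≤ 0 → D.cartan.toSubmodule ≤ N) →
      (∀ c, c ∈ R12 ∧ n ≤ GPair.qf c g → D.rs (vec a b c) ≤ N) → F n ≤ N) := by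
  refine ⟨fun n => (⨆ (_ : n ≤ 0), D.cartan.toSubmodule) ⊔
      ⨆ c : ℤ × ℤ, ⨆ (_ : c ∈ R12 ∧ n ≤ GPair.qf c g), D.rs (vec a b c), ?_, ?_, ?_⟩
  · intro n hn h hh
    apply Submodule.mem_sup_left
    rw [iSup_pos hn]; exact hh
  · intro n c hc hn
    refine le_trans ?_ le_sup_right
    exact le_iSup₂_of_le (f := fun (c : ℤ × ℤ) (_ : c ∈ R12 ∧ n ≤ GPair.qf c g) =>
      D.rs (vec a b c)) c ⟨hc, hn⟩ le_rfl
  · intro n N h1 h2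
    exact sup_le (iSup_le h1) (iSup_le fun c => iSup_le fun hc => h2 c hc)

variable (hp : GPair D.toRootSystemData a b) (hI : D.toRootSystemData.IsIrreducible)
include hp

lemma br_mem {c d : ℤ × ℤ} (hc : c ∈ R12) (hd : d ∈ R12) (hcd : c + d ∈ R12) {x y : L}
    (hx : x ∈ D.rs (vec a b c)) (hy : y ∈ D.rs (vec a b d)) :
    ⁅x, y⁆ ∈ D.rs (vec a b (c + d)) := by
  rw [← vec_add]
  exact D.bracket_mem _ (hp.mem_of_R12 hc) _ (hp.mem_of_R12 hd)
    (by rw [vec_add]; exact hp.mem_of_R12 hcd) x hx y hy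

lemma br_ne {c d : ℤ × ℤ} (hc : c ∈ R12) (hd : d ∈ R12) (hcd : c + d ∈ R12) {x y : L}
    (hx : x ∈ D.rs (vec a b c)) (hy : y ∈ D.rs (vec a b d)) (hx0 : x ≠ 0) (hy0 : y ≠ 0) :
    ⁅x, y⁆ ≠ 0 :=
  D.bracket_ne_zero _ (hp.mem_of_R12 hc) _ (hp.mem_of_R12 hd)
    (by rw [vec_add]; exact hp.mem_of_R12 hcd) x hx hx0 y hy hy0

lemma br_cartan {c d : ℤ × ℤ} (hc : c ∈ R12) (hcd : d = -c) {x y : L}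
    (hx : x ∈ D.rs (vec a b c)) (hy : y ∈ D.rs (vec a b d)) : ⁅x, y⁆ ∈ D.cartan := by
  subst hcd
  rw [← vec_neg] at hy
  exact D.bracket_cartan_mem _ (hp.mem_of_R12 hc) x hx y hy

include hI

lemma br_zero {c d : ℤ × ℤ} (hc : c ∈ R12) (hd : d ∈ R12) (hcd : c + d ∉ R12)
    (h0 : c + d ≠ 0) {x y : L}
    (hx : x ∈ D.rs (vec a b c)) (hy : y ∈ D.rs (vec a b d)) : ⁅x, y⁆ = 0 := by
  refine D.bracket_eq_zero _ (hp.mem_of_R12 hc) _ (hp.mem_of_R12 hd) ?_ ?_ x hx y hy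
  · rw [vec_add, hp.vec_mem_iff hI]; exact hcd
  · rw [vec_add]
    intro e
    apply h0
    apply hp.vec_inj
    rw [e]; simp [vec]

lemma orth_zero {c d : ℤ × ℤ} (hc : c ∈ R12) (hd : d ∈ R12) (hn : -c ∈ R12)
    (h1 : c + d ∉ R12) (h2 : -c + d ∉ R12) (h3 : c + d ≠ 0) (h4 : -c + d ≠ 0) {x u v : L}
    (hx : x ∈ D.rs (vec a b c)) (hu : u ∈ D.rs (vec a b (-c))) (hv : v ∈ D.rs (vec a b d)) :
    ⁅⁅x, u⁆, v⁆ = 0 := by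
  rw [lie_lie, br_zero hp hI hn hd h2 h4 hu hv, br_zero hp hI hc hd h1 h3 hx hv]
  simp

set_option maxHeartbeats 2000000 in
/-- The span of two short root spaces at angle 60 degrees is not spherical. -/
lemma not_spherical (A : Submodule ℂ L) (hA1 : D.rs a ≤ A) (hA2 : D.rs (vec a b (2,1)) ≤ A) :
    ¬ IsSphericalSubspace A := by
  intro hs
  have hA1' : D.rs (vec a b (1,0)) ≤ A := by rw [GPair.veca]; exact hA1
  have hm : ∀ c : ℤ × ℤ, c ∈ R12 → vec a b c ∈ D.roots := fun c hc => hp.mem_of_R12 hc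
  obtain ⟨x, hx, hx0⟩ := D.exists_ne (hm (1,0) (by decide))
  obtain ⟨y, hy, hy0⟩ := D.exists_ne (hm (2,1) (by decide))
  obtain ⟨f, hf, hf0⟩ := D.exists_ne (hm (-3,-1) (by decide))
  obtain ⟨v, hv, hv0⟩ := D.exists_ne (hm (0,1) (by decide))
  have hz : ⁅x, y⁆ ∈ D.rs (vec a b (3,1)) :=
    br_mem hp (c := (1,0)) (d := (2,1)) (by decide) (by decide) (by decide) hx hy
  have hz0 : ⁅x, y⁆ ≠ 0 :=
    br_ne hp (c := (1,0)) (d := (2,1)) (by decide) (by decide) (by decide) hx hy hx0 hy0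
  have hyf : ⁅y, f⁆ ∈ D.rs (vec a b (-1,0)) :=
    br_mem hp (c := (2,1)) (d := (-3,-1)) (by decide) (by decide) (by decide) hy hf
  have hxf : ⁅x, f⁆ ∈ D.rs (vec a b (-2,-1)) :=
    br_mem hp (c := (1,0)) (d := (-3,-1)) (by decide) (by decide) (by decide) hx hf
  have hxv : ⁅x, v⁆ ∈ D.rs (vec a b (1,1)) :=
    br_mem hp (c := (1,0)) (d := (0,1)) (by decide) (by decide) (by decide) hx hv
  have hxv0 : ⁅x, v⁆ ≠ 0 :=
    br_ne hp (c := (1,0)) (d := (0,1)) (by decide) (by decide) (by decide) hx hv hx0 hv0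
  have hzv : ⁅⁅x, y⁆, v⁆ ∈ D.rs (vec a b (3,2)) :=
    br_mem hp (c := (3,1)) (d := (0,1)) (by decide) (by decide) (by decide) hz hv
  have hzv0 : ⁅⁅x, y⁆, v⁆ ≠ 0 :=
    br_ne hp (c := (3,1)) (d := (0,1)) (by decide) (by decide) (by decide) hz hv hz0 hv0
  have hxz : ⁅x, ⁅x, y⁆⁆ = 0 :=
    br_zero hp hI (c := (1,0)) (d := (3,1)) (by decide) (by decide) (by decide) (by decide) hx hz
  have hyz : ⁅y, ⁅x, y⁆⁆ = 0 :=
    br_zero hp hI (c := (2,1)) (d := (3,1)) (by decide) (by decide) (by decide) (by decide) hy hz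
  have hT : ⁅⁅x, y⁆, f⁆ = ⁅x, ⁅y, f⁆⁆ - ⁅y, ⁅x, f⁆⁆ := lie_lie x y f
  have hHc : ⁅x, ⁅y, f⁆⁆ ∈ D.cartan := br_cartan hp (c := (1,0)) (by decide) (by decide) hx hyf
  have hKc : ⁅y, ⁅x, f⁆⁆ ∈ D.cartan := br_cartan hp (c := (2,1)) (by decide) (by decide) hy hxf
  have hHo : ⁅⁅x, ⁅y, f⁆⁆, ⁅⁅x, y⁆, v⁆⁆ = 0 :=
    orth_zero hp hI (c := (1,0)) (d := (3,2)) (by decide) (by decide) (by decide) (by decide)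
      (by decide) (by decide) (by decide) hx hyf hzv
  have hKo : ⁅⁅y, ⁅x, f⁆⁆, v⁆ = 0 :=
    orth_zero hp hI (c := (2,1)) (d := (0,1)) (by decide) (by decide) (by decide) (by decide)
      (by decide) (by decide) (by decide) hy hxf hv
  have hTo : ⁅⁅⁅x, y⁆, f⁆, ⁅x, v⁆⁆ = 0 :=
    orth_zero hp hI (c := (3,1)) (d := (1,1)) (by decide) (by decide) (by decide) (by decide)
      (by decide) (by decide) (by decide) hz hf hxv
  obtain ⟨aH, haH⟩ := D.weight_vec _ (hm (1,0) (by decide)) _ hHc x hx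
  obtain ⟨aK, haK⟩ := D.weight_vec _ (hm (1,0) (by decide)) _ hKc x hx
  obtain ⟨dH, hdH⟩ := D.weight_vec _ (hm (2,1) (by decide)) _ hHc y hy
  obtain ⟨dK, hdK⟩ := D.weight_vec _ (hm (2,1) (by decide)) _ hKc y hy
  obtain ⟨bH, hbH⟩ := D.weight_vec _ (hm (0,1) (by decide)) _ hHc v hv
  have mx := hA1' hx
  have my := hA2 hy
  have id1 := heis_identity x y f aH dH aK dK hxz hyz haH hdH haK hdK
    (hs _ mx) (hs _ my) (hs _ (A.add_mem mx my)) (hs _ (A.sub_mem mx my))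
  have id1' := (smul_eq_zero.mp id1).resolve_right hz0
  obtain ⟨H, hHd⟩ : ∃ H, H = ⁅x, ⁅y, f⁆⁆ := ⟨_, rfl⟩
  obtain ⟨K, hKd⟩ : ∃ K, K = ⁅y, ⁅x, f⁆⁆ := ⟨_, rfl⟩
  rw [← hHd, ← hKd] at hT
  rw [← hHd] at haH hdH hbH hHo
  rw [← hKd] at haK hdK hKo
  -- relation on `K`: automatically `bK = 0`
  have r1 : (aH + dH + bH) • ⁅⁅x, y⁆, v⁆ = 0 := by
    rw [← hHo, leibniz_lie H, leibniz_lie H x y, haH, hdH, hbH]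
    simp only [smul_lie, lie_smul, add_lie]
    module
  have r1' := (smul_eq_zero.mp r1).resolve_right hzv0
  have r2 : (aH + bH - aK) • ⁅x, v⁆ = 0 := by
    rw [← hTo, hT, sub_lie, leibniz_lie H, leibniz_lie K, haH, haK, hbH, hKo]
    simp only [smul_lie, lie_smul, lie_zero]
    module
  have r2' := (smul_eq_zero.mp r2).resolve_right hxv0
  -- additivity: `dH = 2 aH + bH`
  have hxxv : ⁅x, ⁅x, v⁆⁆ ∈ D.rs (vec a b (2,1)) :=
    br_mem hp (c := (1,0)) (d := (1,1)) (by decide) (by decide) (by decide) hx hxv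
  have hxxv0 : ⁅x, ⁅x, v⁆⁆ ≠ 0 :=
    br_ne hp (c := (1,0)) (d := (1,1)) (by decide) (by decide) (by decide) hx hxv hx0 hxv0
  have r3 : dH = 2 * aH + bH := by
    obtain ⟨c, hc⟩ := D.exists_wt (hm (2,1) (by decide)) hHc
    rw [← hHd] at hc
    have c1 : c = dH := by
      have := (hc y hy).symm.trans hdH
      exact smul_left_injective ℂ hy0 this
    have c2 : c = 2 * aH + bH := by
      have := hc _ hxxv
      rw [leibniz_lie H, leibniz_lie H, haH, hbH] at this
      simp only [smul_lie, lie_smul, lie_add] at this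
      have h0 : (c - (2 * aH + bH)) • ⁅x, ⁅x, v⁆⁆ = 0 := by
        rw [sub_smul, ← this]; module
      exact sub_eq_zero.mp ((smul_eq_zero.mp h0).resolve_right hxxv0)
    rw [← c1, c2]
  have hbH0 : bH = 0 := by linear_combination (1/2) * r1' + (3/2) * (r2' + id1') + r3
  -- contradiction
  have hfv : ⁅f, v⁆ = 0 :=
    br_zero hp hI (c := (-3,-1)) (d := (0,1)) (by decide) (by decide) (by decide) (by decide) hf hv
  have hfz : ⁅f, ⁅⁅x, y⁆, v⁆⁆ ≠ 0 :=
    br_ne hp (c := (-3,-1)) (d := (3,2)) (by decide) (by decide) (by decide) hf hzv hf0 hzv0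
  apply hfz
  rw [leibniz_lie, hfv, lie_zero, add_zero, ← lie_skew f, hT, neg_lie, sub_lie, hbH, hKo, hbH0]
  simp

/-- Short root gradings give spherical subspaces. -/
lemma spherical {g : ℤ × ℤ} (hg : g ∈ P6) (hg2 : GPair.qf g g = 2) (S : Set V)
    (hS : ∀ v ∈ S, ∃ c ∈ R12, v = vec a b c ∧ 2 ≤ GPair.qf c g) :
    IsSphericalSubspace (D.aSubspace S) := by
  obtain ⟨F, hF1, hF2, hF3⟩ := exists_filtration (D := D) (a := a) (b := b) g
  have hqa : ∀ c d : ℤ × ℤ, GPair.qf (c + d) g = GPair.qf c g + GPair.qf d g := by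
    intro c d; simp only [GPair.qf, Prod.fst_add, Prod.snd_add]; ring
  have step : ∀ c ∈ R12, 2 ≤ GPair.qf c g → ∀ x ∈ D.rs (vec a b c), ∀ n,
      F n ≤ (F (n + 2)).comap (LieAlgebra.ad ℂ L x : L →ₗ[ℂ] L) := by
    intro c hc hcg x hx n
    refine hF3 _ _ (fun hn => ?_) (fun d hd => ?_)
    · intro u hu
      rw [Submodule.mem_comap, LieAlgebra.ad_apply]
      obtain ⟨t, ht⟩ := D.weight_vec _ (hp.mem_of_R12 hc) u hu x hx
      rw [← lie_skew, ht]
      exact hF2 _ c hc (by omega) ((D.rs _).neg_mem ((D.rs _).smul_mem _ hx))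
    · intro u hu
      rw [Submodule.mem_comap, LieAlgebra.ad_apply]
      by_cases h1 : c + d ∈ R12
      · exact hF2 _ _ h1 (by rw [hqa]; have := hd.2; omega) (br_mem hp hc hd.1 h1 hx hu)
      by_cases h2 : c + d = 0
      · have h3 : d = -c := (neg_eq_of_add_eq_zero_right h2).symm
        have h4 := hqa c d
        rw [h2] at h4
        have h5 : GPair.qf 0 g = 0 := by simp [GPair.qf]
        exact hF1 _ (by have := hd.2; omega) _ (br_cartan hp hc h3 hx hu)
      · rw [br_zero hp hI hc hd.1 h1 h2 hx hu]; exact Submodule.zero_mem _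
  have step2 : ∀ x ∈ D.aSubspace S, ∀ n, ∀ y ∈ F n, ⁅x, y⁆ ∈ F (n + 2) := by
    intro x hx n y hy
    have hle : D.aSubspace S ≤ (F (n + 2)).comap (LieAlgebra.ad ℂ L y : L →ₗ[ℂ] L) := by
      refine iSup_le fun v => iSup_le fun hv => ?_
      obtain ⟨c, hc, rfl, hcg⟩ := hS v hv
      intro u hu
      rw [Submodule.mem_comap, LieAlgebra.ad_apply, ← lie_skew]
      exact (F (n + 2)).neg_mem (step c hc hcg u hu n hy)
    have := hle hx
    rw [Submodule.mem_comap, LieAlgebra.ad_apply, ← lie_skew] at this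
    exact (Submodule.neg_mem_iff _).mp this
  have htop : ∀ y, y ∈ F (-3) := by
    intro y
    have : (⊤ : Submodule ℂ L) ≤ F (-3) := by
      rw [← D.sup_eq_top]
      refine sup_le (fun u hu => hF1 _ (by norm_num) _ hu) (iSup_le fun v => iSup_le fun hv => ?_)
      obtain ⟨c, hc, rfl⟩ := (hp.mem_iff hI).mp hv
      exact hF2 _ c hc (qf_bound g hg hg2 c hc).1
    exact this trivial
  have hbot : ∀ y ∈ F 5, y = 0 := by
    intro y hy
    have : F 5 ≤ ⊥ := by
      refine hF3 _ _ (fun hn => ?_) (fun d hd => ?_)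
      · omega
      · have := (qf_bound g hg hg2 d hd.1).2
        have := hd.2
        omega
    exact (Submodule.mem_bot ℂ).mp (this hy)
  intro x hx
  ext y
  have e : (LieAlgebra.ad ℂ L x ^ 4) y = ⁅x, ⁅x, ⁅x, ⁅x, y⁆⁆⁆⁆ := by
    simp [pow_succ]
  rw [e]
  exact hbot _ (step2 x hx 3 _ (step2 x hx 1 _ (step2 x hx (-1) _ (step2 x hx (-3) _ (htop y)))))

end LieRootData

end LiePart
/-- Suppose `Φ` is of type `G₂` and `w ∈ W`. Then
`𝔞_w = ⊕_{α ∈ Φ(w)} 𝔤_α` is a spherical subspace of `𝔫` if and only if `w` is a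
commutative element. -/
theorem g2_spherical_iff_commutative
    {V : Type*} [NormedAddCommGroup V] [InnerProductSpace ℝ V]
    {L : Type*} [LieRing L] [LieAlgebra ℂ L]
    (D : LieRootData V L)
    (hG2 : D.toRootSystemData.IsG2)
    (w : Module.End ℝ V) (hw : D.toRootSystemData.InWeyl w) :
    IsSphericalSubspace (D.aSubspace (D.toRootSystemData.inversions w)) ↔
      D.toRootSystemData.Commutative w := by
  obtain ⟨a, b, hp, pa, pb⟩ := exists_pos_gpair hG2
  have h : GBase D.toRootSystemData a b := ⟨hp, hG2.1, pa, pb⟩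
  have hle : ∀ v ∈ D.toRootSystemData.inversions w,
      D.rs v ≤ D.aSubspace (D.toRootSystemData.inversions w) := fun v hv =>
    le_iSup₂_of_le (f := fun (v : V) (_ : v ∈ D.toRootSystemData.inversions w) => D.rs v)
      v hv le_rfl
  constructor
  · intro hs
    refine h.commutative_of_long hw fun l hl e => ?_
    rcases h.inv_long l hl with ⟨h1, h2⟩ | ⟨h1, h2⟩
    · rw [e] at h1 h2
      exact LieRootData.not_spherical hp hG2.1 _ (hle _ h1) (hle _ h2) hs
    · rw [e] at h1 h2
      have hq := hp.conj (1,1) (0,-1) (by decide) (by decide) (by decide) (by decide)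
      have ev : vec (vec a b (1,1)) (vec a b (0,-1)) (2,1) = vec a b (2,1) := by
        simp [vec]; module
      exact LieRootData.not_spherical hq hG2.1 _ (hle _ h1) (by rw [ev]; exact hle _ h2) hs
  · intro hc
    obtain ⟨l, hl, rfl⟩ := h.commutative_short hc
    obtain ⟨g, hg, hg2, hk⟩ := h.inv_short l hl
    refine LieRootData.spherical hp hG2.1 hg hg2 _ fun v hv => ?_
    obtain ⟨c, hc, e, hq⟩ := hk v hv
    have hsub : ∀ c ∈ P6, c ∈ R12 := by decide
    exact ⟨c, hsub c hc, e, hq⟩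
end
end

section
/- Suppose 𝔤 is the complex simple Lie algebra of type G₂ and let 𝔞 ⊆ 𝔟 be an ad-nilpotent ideal of the Borel subalgebra 𝔟. Then 𝔞 is a spherical subspace of 𝔫 (i.e. ad(x)⁴ = 0 for every x ∈ 𝔞) if and only if 𝔞 is abelian. -/
/- Background setup: a finite reduced crystallographic root system `Φ` with chosen
positive roots `Φ⁺` in a euclidean space `V`, the Cartan pairing, and the basic
combinatorial notions used in the statement. -/

open scoped RealInnerProductSpace

noncomputable section

variable {V : Type*} [NormedAddCommGroup V] [InnerProductSpace ℝ V]

namespace G2Aux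

section RootPart

variable {V : Type*} [NormedAddCommGroup V] [InnerProductSpace ℝ V]

lemma refl_mem (D : RootSystemData V) {α β : V} (hα : α ∈ D.roots) (hβ : β ∈ D.roots) (c : ℝ)
    (h : 2 * ⟪β, α⟫ = c * ⟪β, β⟫) : α - c • β ∈ D.roots := by
  have h0 : ⟪β, β⟫ ≠ (0 : ℝ) := by
    simpa using D.ne_zero β hβ
  have h1 := D.reflect_mem α hα β hβ
  have h2 : reflEnd β α = α - c • β := by
    have h3 : 2 / ⟪β, β⟫ * ⟪β, α⟫ = c := by
      field_simp
      linarith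
    simp [reflEnd, ← h3]
  rwa [h2] at h1

lemma neg_mem (D : RootSystemData V) {α : V} (hα : α ∈ D.roots) : -α ∈ D.roots := by
  have := refl_mem D hα hα 2 rfl
  rwa [show α - (2 : ℝ) • α = -α by module] at this

/-- A pair consisting of a short and a long root at angle 150 degrees. -/
def G2Pair (D : RootSystemData V) (α β : V) : Prop :=
  α ∈ D.roots ∧ β ∈ D.roots ∧ ⟪β, β⟫ = 3 * ⟪α, α⟫ ∧ 2 * ⟪α, β⟫ = -3 * ⟪α, α⟫

lemma exists_pair (D : RootSystemData V) (h : D.IsG2) : ∃ α β, G2Pair D α β := by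
  obtain ⟨_, b, hb, a, ha, hab⟩ := h
  have key : ∃ b ∈ D.roots, cpair b a = -3 := by
    rcases hab with h | h
    · refine ⟨-b, neg_mem D hb, ?_⟩
      rw [← h]
      simp [cpair, neg_div]
    · exact ⟨b, hb, h⟩
  obtain ⟨b, hb, h⟩ := key
  obtain ⟨k, hk⟩ := D.crystallographic a ha b hb
  have ha0 : 0 < ⟪a, a⟫ := real_inner_self_pos.2 (D.ne_zero a ha)
  have hb0 : 0 < ⟪b, b⟫ := real_inner_self_pos.2 (D.ne_zero b hb)
  unfold cpair at h hk
  rw [div_eq_iff ha0.ne'] at h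
  rw [div_eq_iff hb0.ne', real_inner_comm] at hk
  have hcs := real_inner_mul_inner_self_le b a
  have hk0 : (k : ℝ) < 0 := by
    by_contra hcon
    push Not at hcon
    have := mul_nonneg hcon hb0.le
    linarith
  have hk2 : (-2 : ℝ) < k := by
    by_contra hcon
    push Not at hcon
    have h1 : (2 * ⟪b, a⟫) * (2 * ⟪b, a⟫) = (-3 * k) * (⟪b, b⟫ * ⟪a, a⟫) := by
      nth_rewrite 1 [h]
      rw [hk]; ring
    have h2 := mul_pos hb0 ha0
    nlinarith
  have hk1 : k = -1 := by
    have h1 : k < 0 := by exact_mod_cast hk0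
    have h2 : -2 < k := by exact_mod_cast hk2
    omega
  subst hk1
  refine ⟨a, b, ha, hb, ?_, ?_⟩
  · push_cast at hk; linarith
  · rw [real_inner_comm]; linarith

/-- Integer linear combinations of `α` and `β`. -/
def lc (α β : V) (p : ℤ × ℤ) : V := (p.1 : ℝ) • α + (p.2 : ℝ) • β

lemma lc_add (α β : V) (p q : ℤ × ℤ) : lc α β (p + q) = lc α β p + lc α β q := by
  simp only [lc, Prod.fst_add, Prod.snd_add]
  push_cast
  module

lemma lc_neg (α β : V) (p : ℤ × ℤ) : lc α β (-p) = -lc α β p := by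
  simp only [lc, Prod.fst_neg, Prod.snd_neg]
  push_cast
  module

/-- The positive roots of `G₂` in coordinates. -/
def P : Finset (ℤ × ℤ) := {(1, 0), (0, 1), (1, 1), (2, 1), (3, 1), (3, 2)}

/-- The roots of `G₂` in coordinates. -/
def R : Finset (ℤ × ℤ) :=
  {(1, 0), (0, 1), (1, 1), (2, 1), (3, 1), (3, 2),
   (-1, 0), (0, -1), (-1, -1), (-2, -1), (-3, -1), (-3, -2)}

lemma lc_mem_pos_part (D : RootSystemData V) {α β : V} (h : G2Pair D α β) :
    ∀ p ∈ P, lc α β p ∈ D.roots := by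
  obtain ⟨hα, hβ, h1, h2⟩ := h
  have h2' : 2 * ⟪β, α⟫ = -3 * ⟪α, α⟫ := by rw [real_inner_comm]; exact h2
  have r1 := refl_mem D hβ hα (-3) h2
  have r2 := refl_mem D hα hβ (-1) (by linarith)
  have r3 := refl_mem D r2 hα (-1) (by
    simp only [inner_sub_right, inner_smul_right]; linarith)
  have r4 := refl_mem D r1 hβ (-1) (by
    simp only [inner_sub_right, inner_smul_right]; linarith)
  intro p hp
  simp only [P, Finset.mem_insert, Finset.mem_singleton] at hp
  rcases hp with rfl | rfl | rfl | rfl | rfl | rfl <;> simp only [lc] <;> push_cast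
  · convert hα using 1; module
  · convert hβ using 1; module
  · convert r2 using 1; module
  · convert r3 using 1; module
  · convert r1 using 1; module
  · convert r4 using 1; module

lemma R_cases : ∀ p ∈ R, p ∈ P ∨ -p ∈ P := by decide

lemma lc_mem (D : RootSystemData V) {α β : V} (h : G2Pair D α β) :
    ∀ p ∈ R, lc α β p ∈ D.roots := by
  intro p hp
  rcases R_cases p hp with hp | hp
  · exact lc_mem_pos_part D h p hp
  · have := neg_mem D (lc_mem_pos_part D h _ hp)
    rwa [lc_neg, neg_neg] at this

lemma arith_fin : ∀ m ∈ Finset.Icc (-3 : ℤ) 3, ∀ n ∈ Finset.Icc (-2 : ℤ) 2,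
    m ^ 2 + 3 * m * n + 3 * n ^ 2 ≤ 3 → ¬ (m = 0 ∧ n = 0) →
    (2 * m + 3 * n, m + 2 * n) ∈ R ∧
      (m ^ 2 + 3 * m * n + 3 * n ^ 2 = 3 ∨
      (m ^ 2 + 3 * m * n + 3 * n ^ 2 = 1 ∧ ∃ a ∈ Finset.Icc (-1 : ℤ) 1,
        ∃ b ∈ Finset.Icc (-1 : ℤ) 1, a * m + b * (3 * n) = 1)) := by
  decide

lemma arith (m n k j : ℤ) (g : ℝ) (hg : 0 < g) (hm : (m : ℝ) = g * k) (hn : 3 * (n : ℝ) = g * j)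
    (hQ : ((m ^ 2 + 3 * m * n + 3 * n ^ 2 : ℤ) : ℝ) ≤ g) (h0 : ¬ (m = 0 ∧ n = 0)) :
    g = ((m ^ 2 + 3 * m * n + 3 * n ^ 2 : ℤ) : ℝ) ∧ (2 * m + 3 * n, m + 2 * n) ∈ R := by
  have hF : 1 ≤ 3 * k ^ 2 + 3 * k * j + j ^ 2 := by
    by_contra hcon
    have hk : k = 0 := by
      have : k ^ 2 < 1 := by nlinarith [sq_nonneg (3 * k + 2 * j)]
      nlinarith [sq_nonneg (k)]
    have hj : j = 0 := by
      subst hk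
      nlinarith [sq_nonneg j]
    subst hk hj
    apply h0
    constructor
    · have : (m : ℝ) = 0 := by simpa using hm
      exact_mod_cast this
    · have : (n : ℝ) = 0 := by
        have : 3 * (n : ℝ) = 0 := by simpa using hn
        linarith
      exact_mod_cast this
  have hF' : (1 : ℝ) ≤ 3 * k ^ 2 + 3 * k * j + j ^ 2 := by exact_mod_cast hF
  have hg3 : g ≤ 3 := by
    have e : 3 * ((m ^ 2 + 3 * m * n + 3 * n ^ 2 : ℤ) : ℝ)
        = g * (g * (3 * k ^ 2 + 3 * k * j + j ^ 2)) := by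
      have hn' : (n : ℝ) = g * j / 3 := by linarith
      push_cast
      rw [hm, hn']; ring
    have : g * (g * (3 * k ^ 2 + 3 * k * j + j ^ 2)) ≤ g * 3 := by linarith
    have := le_of_mul_le_mul_left this hg
    nlinarith
  have hQ3 : m ^ 2 + 3 * m * n + 3 * n ^ 2 ≤ 3 := by
    have : ((m ^ 2 + 3 * m * n + 3 * n ^ 2 : ℤ) : ℝ) ≤ 3 := hQ.trans hg3
    exact_mod_cast this
  have hn1 : n ≤ 2 := by nlinarith [sq_nonneg (2 * m + 3 * n)]
  have hn2 : -2 ≤ n := by nlinarith [sq_nonneg (2 * m + 3 * n)]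
  have hm1 : m ≤ 3 := by nlinarith [sq_nonneg (m + 2 * n)]
  have hm2 : -3 ≤ m := by nlinarith [sq_nonneg (m + 2 * n)]
  have pos1 : ∀ t : ℤ, g * t = 1 → 1 ≤ g → g = 1 := by
    intro t ht hg1
    have : 0 < (t : ℝ) := by
      by_contra hcon
      nlinarith
    have : (1 : ℝ) ≤ t := by
      have : 0 < t := by exact_mod_cast this
      exact_mod_cast this
    nlinarith
  have hmem : (2 * m + 3 * n, m + 2 * n) ∈ R ∧
      (m ^ 2 + 3 * m * n + 3 * n ^ 2 = 3 ∨
      (m ^ 2 + 3 * m * n + 3 * n ^ 2 = 1 ∧ ∃ a b : ℤ, a * m + b * (3 * n) = 1)) := by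
    obtain ⟨h1, h2⟩ := arith_fin m (Finset.mem_Icc.2 ⟨hm2, hm1⟩) n (Finset.mem_Icc.2 ⟨hn2, hn1⟩)
      hQ3 h0
    refine ⟨h1, h2.imp_right ?_⟩
    rintro ⟨h3, a, -, b, -, hab⟩
    exact ⟨h3, a, b, hab⟩
  refine ⟨?_, hmem.1⟩
  rcases hmem.2 with h | ⟨h, a, b, hab⟩
  · rw [h] at hQ ⊢
    push_cast at hQ ⊢
    linarith
  · rw [h] at hQ ⊢
    push_cast at hQ ⊢
    refine pos1 (a * k + b * j) ?_ hQ
    have : (a : ℝ) * m + b * (3 * n) = 1 := by exact_mod_cast hab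
    rw [hm, hn] at this
    push_cast
    linarith

lemma mem_lc_or_orth (D : RootSystemData V) {α β : V} (h : G2Pair D α β) {γ : V}
    (hγ : γ ∈ D.roots) : (∃ p ∈ R, lc α β p = γ) ∨ (⟪α, γ⟫ = 0 ∧ ⟪β, γ⟫ = 0) := by
  obtain ⟨hα, hβ, h1, h2⟩ := h
  have hN : 0 < ⟪α, α⟫ := real_inner_self_pos.2 (D.ne_zero α hα)
  have hG : 0 < ⟪γ, γ⟫ := real_inner_self_pos.2 (D.ne_zero γ hγ)
  obtain ⟨m, hm⟩ := D.crystallographic γ hγ α hα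
  obtain ⟨n, hn⟩ := D.crystallographic γ hγ β hβ
  obtain ⟨k, hk⟩ := D.crystallographic α hα γ hγ
  obtain ⟨j, hj⟩ := D.crystallographic β hβ γ hγ
  unfold cpair at hm hn hk hj
  rw [div_eq_iff (by rw [h1]; positivity), h1, real_inner_comm] at hn
  rw [div_eq_iff hN.ne', real_inner_comm] at hm
  rw [div_eq_iff hG.ne'] at hk hj
  by_cases h0 : m = 0 ∧ n = 0
  · right
    obtain ⟨rfl, rfl⟩ := h0
    push_cast at hm hn
    constructor <;> linarith
  left
  generalize hNN : ⟪α, α⟫ = N at *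
  have hgg : ⟪γ, γ⟫ = (⟪γ, γ⟫ / N) * N := by field_simp
  generalize hg : ⟪γ, γ⟫ / N = g at *
  have hg0 : 0 < g := by rw [← hg]; positivity
  have hQ : ⟪γ - lc α β (2 * m + 3 * n, m + 2 * n), γ - lc α β (2 * m + 3 * n, m + 2 * n)⟫
      = N * (g - ((m ^ 2 + 3 * m * n + 3 * n ^ 2 : ℤ) : ℝ)) := by
    simp only [lc, inner_sub_left, inner_sub_right, inner_add_left, inner_add_right,
      inner_smul_left, inner_smul_right, conj_trivial]
    rw [real_inner_comm α γ, real_inner_comm β γ, real_inner_comm α β, hgg, hNN, h1,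
      show ⟪α, γ⟫ = m * N / 2 by linarith, show ⟪β, γ⟫ = n * (3 * N) / 2 by linarith,
      show ⟪α, β⟫ = -3 * N / 2 by linarith]
    push_cast
    ring
  have hle : ((m ^ 2 + 3 * m * n + 3 * n ^ 2 : ℤ) : ℝ) ≤ g := by
    have := real_inner_self_nonneg (x := γ - lc α β (2 * m + 3 * n, m + 2 * n))
    rw [hQ] at this
    have := nonneg_of_mul_nonneg_right this hN
    linarith
  obtain ⟨he, hmem⟩ := arith m n k j g hg0
    (by
      have : (m : ℝ) * N = g * k * N := by rw [← hm, hk, hgg]; ring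
      exact mul_right_cancel₀ hN.ne' this)
    (by
      have : 3 * (n : ℝ) * N = g * j * N := by
        have : (n : ℝ) * (3 * N) = j * (g * N) := by rw [← hn, hj, hgg]
        linarith
      exact mul_right_cancel₀ hN.ne' this) hle h0
  refine ⟨_, hmem, ?_⟩
  rw [← he, sub_self, mul_zero, inner_self_eq_zero, sub_eq_zero] at hQ
  exact hQ.symm

lemma roots_eq (D : RootSystemData V) (hG : D.IsG2) {α β : V} (h : G2Pair D α β) {γ : V}
    (hγ : γ ∈ D.roots) : ∃ p ∈ R, lc α β p = γ := by
  have := hG.1.2 {γ ∈ D.roots | ∃ p ∈ R, lc α β p = γ} (fun _ hx => hx.1) (by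
    rintro x ⟨hx, p, hp, rfl⟩ y ⟨hy, hy'⟩
    rcases mem_lc_or_orth D h hy with h' | ⟨h1, h2⟩
    · exact absurd ⟨hy, h'⟩ hy'
    · simp [lc, inner_add_left, inner_smul_left, h1, h2])
  rcases this with h' | h'
  · exfalso
    have : α ∈ {γ ∈ D.roots | ∃ p ∈ R, lc α β p = γ} := ⟨h.1, (1, 0), by decide, by simp [lc]⟩
    rw [h'] at this
    exact this
  · rw [← h'] at hγ
    exact hγ.2

lemma G2Pair.neg {D : RootSystemData V} {α β : V} (h : G2Pair D α β) : G2Pair D (-α) (-β) :=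
  ⟨neg_mem D h.1, neg_mem D h.2.1, by simpa using h.2.2.1, by simpa using h.2.2.2⟩

lemma G2Pair.lcPair {D : RootSystemData V} {α β : V} (h : G2Pair D α β) (p q : ℤ × ℤ)
    (hp : p ∈ R) (hq : q ∈ R)
    (h1 : q.1 ^ 2 - 3 * q.1 * q.2 + 3 * q.2 ^ 2 = 3)
    (h1' : p.1 ^ 2 - 3 * p.1 * p.2 + 3 * p.2 ^ 2 = 1)
    (h2 : 2 * p.1 * q.1 - 3 * p.1 * q.2 - 3 * p.2 * q.1 + 6 * p.2 * q.2 = -3) :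
    G2Pair D (lc α β p) (lc α β q) := by
  have key : ∀ p q : ℤ × ℤ, 2 * ⟪lc α β p, lc α β q⟫ =
      ((2 * p.1 * q.1 - 3 * p.1 * q.2 - 3 * p.2 * q.1 + 6 * p.2 * q.2 : ℤ) : ℝ) * ⟪α, α⟫ := by
    intro p q
    simp only [lc, inner_add_left, inner_add_right,
      inner_smul_left, inner_smul_right, conj_trivial]
    rw [real_inner_comm α β, h.2.2.1,
      show ⟪α, β⟫ = -3 * ⟪α, α⟫ / 2 by linarith [h.2.2.2]]
    push_cast
    ring
  have k1 := key p p
  have k2 := key q q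
  have k3 := key p q
  rw [show 2 * p.1 * p.1 - 3 * p.1 * p.2 - 3 * p.2 * p.1 + 6 * p.2 * p.2 = 2 by linarith] at k1
  rw [show 2 * q.1 * q.1 - 3 * q.1 * q.2 - 3 * q.2 * q.1 + 6 * q.2 * q.2 = 6 by linarith] at k2
  rw [h2] at k3
  push_cast at k1 k2 k3
  exact ⟨lc_mem D h p hp, lc_mem D h q hq, by linarith, by linarith⟩

lemma exists_pos_pair (D : RootSystemData V) (h : D.IsG2) :
    ∃ α β, G2Pair D α β ∧ α ∈ D.pos ∧ β ∈ D.pos := by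
  by_contra! hcon
  have key : ∀ α β, G2Pair D α β → (α ∈ D.pos ↔ ¬ β ∈ D.pos) := by
    intro α β h
    have h1 := hcon α β h
    have h2 := hcon _ _ h.neg
    have h3 := D.pos_iff α h.1
    have h4 := D.pos_iff β h.2.1
    tauto
  obtain ⟨α, β, h⟩ := exists_pair D h
  have sgn : ∀ p ∈ R, (lc α β (-p) ∈ D.pos ↔ ¬ lc α β p ∈ D.pos) := by
    intro p hp
    rw [D.pos_iff _ (lc_mem D h p hp), lc_neg, not_not]
  have f := fun p q hp hq h1 h2 h3 => key _ _ (h.lcPair p q hp hq h1 h2 h3)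
  have e1 := f (1, 0) (0, 1) (by decide) (by decide) (by decide) (by decide) (by decide)
  have e2 := f (1, 0) (-(3, 1)) (by decide) (by decide) (by decide) (by decide) (by decide)
  have e3 := f (2, 1) (-(3, 1)) (by decide) (by decide) (by decide) (by decide) (by decide)
  have e4 := f (2, 1) (-(3, 2)) (by decide) (by decide) (by decide) (by decide) (by decide)
  have e5 := f (1, 1) (-(3, 2)) (by decide) (by decide) (by decide) (by decide) (by decide)
  have e6 := f (1, 1) (-(0, 1)) (by decide) (by decide) (by decide) (by decide) (by decide)
  rw [sgn _ (by decide)] at e2 e3 e4 e5 e6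
  tauto

lemma lc_pos (D : RootSystemData V) {α β : V} (h : G2Pair D α β) (hα : α ∈ D.pos)
    (hβ : β ∈ D.pos) : ∀ p ∈ P, lc α β p ∈ D.pos := by
  have e10 : lc α β (1, 0) ∈ D.pos := by simpa [lc] using hα
  have e01 : lc α β (0, 1) ∈ D.pos := by simpa [lc] using hβ
  have add : ∀ p q, p + q ∈ R → lc α β p ∈ D.pos → lc α β q ∈ D.pos →
      lc α β (p + q) ∈ D.pos := by
    intro p q hpq hp hq
    have := lc_mem D h _ hpq
    rw [lc_add] at this ⊢
    exact D.pos_add _ hp _ hq this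
  have e11 := add (1, 0) (0, 1) (by decide) e10 e01
  have e21 := add (1, 0) ((1, 0) + (0, 1)) (by decide) e10 e11
  have e31 := add (1, 0) _ (by decide) e10 e21
  have e32 := add (0, 1) _ (by decide) e01 e31
  intro p hp
  simp only [P, Finset.mem_insert, Finset.mem_singleton] at hp
  rcases hp with rfl | rfl | rfl | rfl | rfl | rfl
  · exact e10
  · exact e01
  · exact e11
  · exact e21
  · exact e31
  · exact e32

lemma pos_eq (D : RootSystemData V) (hG : D.IsG2) {α β : V} (h : G2Pair D α β) (hα : α ∈ D.pos)
    (hβ : β ∈ D.pos) {γ : V} (hγ : γ ∈ D.pos) : ∃ p ∈ P, lc α β p = γ := by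
  obtain ⟨p, hp, rfl⟩ := roots_eq D hG h (D.pos_subset hγ)
  rcases R_cases p hp with hp' | hp'
  · exact ⟨p, hp', rfl⟩
  · have h1 := lc_pos D h hα hβ _ hp'
    rw [lc_neg] at h1
    exact absurd h1 ((D.pos_iff _ (lc_mem D h p hp)).1 hγ)

lemma lc_inj (D : RootSystemData V) {α β : V} (h : G2Pair D α β) (p : ℤ × ℤ)
    (hp : lc α β p = 0) : p = 0 := by
  have hN : 0 < ⟪α, α⟫ := real_inner_self_pos.2 (D.ne_zero α h.1)
  have e1 : ⟪lc α β p, lc α β (2, 1)⟫ = 0 := by rw [hp, inner_zero_left]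
  have e2 : ⟪lc α β p, lc α β (3, 2)⟫ = 0 := by rw [hp, inner_zero_left]
  simp only [lc, inner_add_left, inner_add_right,
      inner_smul_left, inner_smul_right, conj_trivial] at e1 e2
  rw [real_inner_comm α β, h.2.2.1,
      show ⟪α, β⟫ = -3 * ⟪α, α⟫ / 2 by linarith [h.2.2.2]] at e1 e2
  push_cast at e1 e2
  have e1' : (p.1 : ℝ) * ⟪α, α⟫ = 0 := by linarith
  have e2' : (p.2 : ℝ) * ⟪α, α⟫ = 0 := by linarith
  have f1 : (p.1 : ℝ) = 0 := (mul_eq_zero.1 e1').resolve_right hN.ne'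
  have f2 : (p.2 : ℝ) = 0 := (mul_eq_zero.1 e2').resolve_right hN.ne'
  exact Prod.ext (by exact_mod_cast f1) (by exact_mod_cast f2)

lemma lc_injective (D : RootSystemData V) {α β : V} (h : G2Pair D α β) (p q : ℤ × ℤ)
    (hp : lc α β p = lc α β q) : p = q := by
  have : lc α β (p + -q) = 0 := by rw [lc_add, lc_neg, hp, add_neg_cancel]
  have := lc_inj D h _ this
  exact add_neg_eq_zero.1 this

end RootPart

section LiePart

variable {V : Type*} [NormedAddCommGroup V] [InnerProductSpace ℝ V]
  {L : Type*} [LieRing L] [LieAlgebra ℂ L]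

/-- The graded pieces of `L` in coordinates. -/
def gz (D : LieRootData V L) (α β : V) (p : ℤ × ℤ) : Submodule ℂ L :=
  if p = 0 then D.cartan.toSubmodule else if p ∈ R then D.rs (lc α β p) else ⊥

/-- Sums of graded pieces. -/
def GS (D : LieRootData V L) (α β : V) (S : Finset (ℤ × ℤ)) : Submodule ℂ L :=
  ⨆ p ∈ S, gz D α β p

lemma zero_notMem_R : (0 : ℤ × ℤ) ∉ R := by decide

lemma gz_of_mem (D : LieRootData V L) (α β : V) {p : ℤ × ℤ} (hp : p ∈ R) :
    gz D α β p = D.rs (lc α β p) := by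
  have : p ≠ 0 := fun h => zero_notMem_R (h ▸ hp)
  simp [gz, this, hp]

lemma neg_mem_R : ∀ p ∈ R, -p ∈ R := by decide

variable (D : LieRootData V L) {α β : V}

lemma bracket_gz (hG : D.toRootSystemData.IsG2) (h : G2Pair D.toRootSystemData α β)
    {p q : ℤ × ℤ} {x y : L} (hp : p ∈ R) (hx : x ∈ gz D α β p)
    (hy : y ∈ gz D α β q) : ⁅x, y⁆ ∈ gz D α β (p + q) := by
  have hpr := lc_mem _ h p hp
  by_cases hq0 : q = 0
  · subst hq0
    rw [add_zero]
    rw [gz_of_mem D α β hp] at hx ⊢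
    obtain ⟨c, hc⟩ := D.weight_vec _ hpr y (by simpa [gz] using hy) x hx
    rw [← lie_skew, hc]
    exact Submodule.neg_mem _ (Submodule.smul_mem _ _ hx)
  by_cases hq : q ∈ R
  · have hqr := lc_mem _ h q hq
    rw [gz_of_mem D α β hp] at hx
    rw [gz_of_mem D α β hq] at hy
    by_cases h0 : p + q = 0
    · have : q = -p := by rw [eq_neg_iff_add_eq_zero, add_comm]; exact h0
      subst this
      rw [lc_neg] at hy
      simpa [gz] using D.bracket_cartan_mem _ hpr x hx y hy
    by_cases h1 : p + q ∈ R
    · have hr := lc_mem _ h _ h1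
      rw [gz_of_mem D α β h1]
      rw [lc_add] at hr ⊢
      exact D.bracket_mem _ hpr _ hqr hr x hx y hy
    · have : ⁅x, y⁆ = 0 := by
        refine D.bracket_eq_zero _ hpr _ hqr ?_ ?_ x hx y hy
        · rw [← lc_add]
          intro hmem
          obtain ⟨r, hr, hr'⟩ := roots_eq _ hG h hmem
          rw [lc_injective _ h _ _ hr'] at hr
          exact h1 hr
        · rw [← lc_add]
          exact fun hh => h0 (lc_inj _ h _ hh)
      rw [this]
      exact Submodule.zero_mem _
  · have : y = 0 := by simpa [gz, hq0, hq] using hy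
    rw [this, lie_zero]
    exact Submodule.zero_mem _

lemma bracket_ne (h : G2Pair D.toRootSystemData α β)
    {p q : ℤ × ℤ} {x y : L} (hp : p ∈ R) (hq : q ∈ R) (hpq : p + q ∈ R)
    (hx : x ∈ gz D α β p) (hx0 : x ≠ 0)
    (hy : y ∈ gz D α β q) (hy0 : y ≠ 0) : ⁅x, y⁆ ≠ 0 := by
  rw [gz_of_mem D α β hp] at hx
  rw [gz_of_mem D α β hq] at hy
  refine D.bracket_ne_zero _ (lc_mem _ h p hp) _ (lc_mem _ h q hq) ?_ x hx hx0 y hy hy0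
  rw [← lc_add]
  exact lc_mem _ h _ hpq

lemma exists_ne (h : G2Pair D.toRootSystemData α β)
    {p : ℤ × ℤ} (hp : p ∈ R) : ∃ x ∈ gz D α β p, x ≠ 0 := by
  rw [gz_of_mem D α β hp]
  have := D.rs_dim _ (lc_mem _ h p hp)
  by_contra! hcon
  have hb : D.rs (lc α β p) = ⊥ := (Submodule.eq_bot_iff _).2 hcon
  rw [hb] at this
  simp at this

lemma gz_le_GS {S : Finset (ℤ × ℤ)} {p : ℤ × ℤ} (hp : p ∈ S) : gz D α β p ≤ GS D α β S :=
  le_iSup₂_of_le p hp le_rfl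

lemma gz_eq_bot {p : ℤ × ℤ} (hp : p ∉ R) (hp0 : p ≠ 0) : gz D α β p = ⊥ := by
  simp [gz, hp, hp0]

lemma bracket_GS (hG : D.toRootSystemData.IsG2) (h : G2Pair D.toRootSystemData α β)
    (S T U : Finset (ℤ × ℤ)) {x y : L} (hx : x ∈ GS D α β S) (hy : y ∈ GS D α β T)
    (hS : ∀ s ∈ S, s ∈ R)
    (hU : ∀ s ∈ S, ∀ t ∈ T, s + t ∈ insert 0 R → s + t ∈ U) : ⁅x, y⁆ ∈ GS D α β U := by
  have step : ∀ s ∈ S, ∀ x ∈ gz D α β s, ∀ t ∈ T, ∀ y ∈ gz D α β t, ⁅x, y⁆ ∈ GS D α β U := by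
    intro s hs x hx t ht y hy
    have hb := bracket_gz D hG h (hS s hs) hx hy
    by_cases hst : s + t ∈ insert 0 R
    · exact gz_le_GS D (hU s hs t ht hst) hb
    · rw [Finset.mem_insert, not_or] at hst
      rw [gz_eq_bot D hst.2 hst.1, Submodule.mem_bot] at hb
      rw [hb]
      exact Submodule.zero_mem _
  have step2 : ∀ s ∈ S, ∀ x ∈ gz D α β s, ⁅x, y⁆ ∈ GS D α β U := by
    intro s hs x hx
    have : GS D α β T ≤ (GS D α β U).comap (LieAlgebra.ad ℂ L x) :=
      iSup₂_le fun t ht y hy => step s hs x hx t ht y hy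
    exact this hy
  have : GS D α β S ≤ (GS D α β U).comap (LieAlgebra.ad ℂ L y) := by
    refine iSup₂_le fun s hs x hx => ?_
    have := step2 s hs x hx
    rw [← lie_skew] at this
    exact (Submodule.neg_mem_iff (GS D α β U)).1 this
  have := this hx
  rw [← lie_skew]
  exact Submodule.neg_mem _ this

/-- The roots of the maximal abelian ideal. -/
def IS : Finset (ℤ × ℤ) := {(2, 1), (3, 1), (3, 2)}

lemma mem_single {p : ℤ × ℤ} {x : L} : x ∈ gz D α β p ↔ x ∈ GS D α β {p} := by
  simp [GS]

lemma eq_zero_of_GS {x : L} (hx : x ∈ GS D α β ∅) : x = 0 := by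
  simpa [GS] using hx

lemma GS_top (hG : D.toRootSystemData.IsG2) (h : G2Pair D.toRootSystemData α β)
    : GS D α β (insert 0 R) = ⊤ := by
  rw [eq_top_iff, ← D.sup_eq_top]
  refine sup_le ?_ (iSup₂_le fun γ hγ => ?_)
  · refine le_trans (le_of_eq ?_) (gz_le_GS D (Finset.mem_insert_self 0 R))
    simp [gz]
  · obtain ⟨p, hp, rfl⟩ := roots_eq _ hG h hγ
    rw [← gz_of_mem D α β hp]
    exact gz_le_GS D (Finset.mem_insert_of_mem hp)

lemma nilrad_le (hG : D.toRootSystemData.IsG2) (h : G2Pair D.toRootSystemData α β)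
    (hα : α ∈ D.pos) (hβ : β ∈ D.pos) : D.nilrad ≤ GS D α β P := by
  refine iSup₂_le fun γ hγ => ?_
  obtain ⟨p, hp, rfl⟩ := pos_eq _ hG h hα hβ hγ
  rw [← gz_of_mem D α β ((by decide : ∀ p ∈ P, p ∈ R) p hp)]
  exact gz_le_GS D hp

lemma gz_le_borel (h : G2Pair D.toRootSystemData α β)
    (hα : α ∈ D.pos) (hβ : β ∈ D.pos) {p : ℤ × ℤ} (hp : p ∈ P) :
    gz D α β p ≤ D.borel := by
  rw [gz_of_mem D α β ((by decide : ∀ p ∈ P, p ∈ R) p hp)]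
  exact le_sup_of_le_right (le_iSup₂_of_le _ (lc_pos _ h hα hβ p hp) le_rfl)

lemma IS_spherical (hG : D.toRootSystemData.IsG2) (h : G2Pair D.toRootSystemData α β)
    {x : L} (hx : x ∈ GS D α β IS) : (LieAlgebra.ad ℂ L x) ^ 4 = 0 := by
  ext y
  have hy : y ∈ GS D α β (insert 0 R) := by rw [GS_top D hG h]; trivial
  have h1 := bracket_GS D hG h IS _ ((insert 0 R).filter fun p => -1 ≤ p.1) hx hy
    (by decide) (by decide)
  have h2 := bracket_GS D hG h IS _ ((insert 0 R).filter fun p => 1 ≤ p.1) hx h1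
    (by decide) (by decide)
  have h3 := bracket_GS D hG h IS _ ((insert 0 R).filter fun p => 3 ≤ p.1) hx h2
    (by decide) (by decide)
  have h4 := bracket_GS D hG h IS _ ∅ hx h3 (by decide) (by decide)
  simpa [pow_succ] using eq_zero_of_GS D h4

lemma IS_abelian (hG : D.toRootSystemData.IsG2) (h : G2Pair D.toRootSystemData α β)
    {x y : L} (hx : x ∈ GS D α β IS) (hy : y ∈ GS D α β IS) : ⁅x, y⁆ = 0 :=
  eq_zero_of_GS D (bracket_GS D hG h IS IS ∅ hx hy (by decide) (by decide))

lemma decomp {y : L} (hy : y ∈ GS D α β P) : ∃ y1 ∈ gz D α β (1, 0), ∃ y2 ∈ gz D α β (0, 1),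
    ∃ y3 ∈ gz D α β (1, 1), ∃ r ∈ GS D α β IS, y1 + (y2 + (y3 + r)) = y := by
  have hle : GS D α β P ≤
      gz D α β (1, 0) ⊔ (gz D α β (0, 1) ⊔ (gz D α β (1, 1) ⊔ GS D α β IS)) := by
    refine iSup₂_le fun p hp => ?_
    have : p = (1, 0) ∨ p = (0, 1) ∨ p = (1, 1) ∨ p ∈ IS :=
      (by decide : ∀ p ∈ P, p = (1, 0) ∨ p = (0, 1) ∨ p = (1, 1) ∨ p ∈ IS) p hp
    rcases this with rfl | rfl | rfl | hp
    · exact le_sup_left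
    · exact le_sup_of_le_right le_sup_left
    · exact le_sup_of_le_right (le_sup_of_le_right le_sup_left)
    · exact le_sup_of_le_right (le_sup_of_le_right (le_sup_of_le_right (gz_le_GS D hp)))
  obtain ⟨y1, h1, z, hz, rfl⟩ := Submodule.mem_sup.1 (hle hy)
  obtain ⟨y2, h2, w, hw, rfl⟩ := Submodule.mem_sup.1 hz
  obtain ⟨y3, h3, r, hr, rfl⟩ := Submodule.mem_sup.1 hw
  exact ⟨y1, h1, y2, h2, y3, h3, r, hr, rfl⟩

lemma bracket_gz' (hG : D.toRootSystemData.IsG2) (h : G2Pair D.toRootSystemData α β)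
    (p q s : ℤ × ℤ) {x y : L} (hp : p ∈ R) (hs : s = p + q)
    (hx : x ∈ gz D α β p) (hy : y ∈ gz D α β q) : ⁅x, y⁆ ∈ gz D α β s :=
  hs ▸ bracket_gz D hG h hp hx hy

/-- An ideal not contained in the maximal abelian ideal contains an element with leading term
in the root space of `α + β`. -/
lemma exists_leading (hG : D.toRootSystemData.IsG2) (h : G2Pair D.toRootSystemData α β)
    (hα : α ∈ D.pos) (hβ : β ∈ D.pos) (a : Submodule ℂ L) (ha : a ≤ D.nilrad)
    (hideal : ∀ x ∈ D.borel, ∀ y ∈ a, ⁅x, y⁆ ∈ a) (hnot : ¬ a ≤ GS D α β IS) :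
    ∃ u ∈ gz D α β (1, 1), u ≠ 0 ∧ ∃ r ∈ GS D α β IS, u + r ∈ a := by
  obtain ⟨y, hya, hy⟩ := Set.not_subset.1 hnot
  obtain ⟨y1, h1, y2, h2, y3, h3, r, hr, rfl⟩ := decomp D (nilrad_le D hG h hα hβ (ha hya))
  obtain ⟨ea, hea, hea0⟩ := exists_ne D h (p := (1, 0)) (by decide)
  obtain ⟨eb, heb, heb0⟩ := exists_ne D h (p := (0, 1)) (by decide)
  have h3' : y3 + r ∈ GS D α β (insert (1, 1) IS) := by
    refine Submodule.add_mem _ (gz_le_GS D (Finset.mem_insert_self _ _) h3) ?_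
    exact (biSup_mono (fun p hp => Finset.mem_insert_of_mem hp) :
      GS D α β IS ≤ GS D α β (insert (1, 1) IS)) hr
  by_cases hy1 : y1 = 0
  · by_cases hy2 : y2 = 0
    · refine ⟨y3, h3, ?_, r, hr, by simpa [hy1, hy2] using hya⟩
      rintro rfl
      exact hy (by simpa [hy1, hy2] using hr)
    · have hm := hideal _ (gz_le_borel D h hα hβ (by decide) hea) _ hya
      rw [hy1, zero_add, lie_add] at hm
      refine ⟨_, bracket_gz' D hG h (1, 0) (0, 1) (1, 1) (by decide) (by decide) hea h2,
        bracket_ne D h (by decide) (by decide) (by decide) hea hea0 h2 hy2, _, ?_, hm⟩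
      exact bracket_GS D hG h {(1, 0)} _ _ ((mem_single D).1 hea) h3' (by decide) (by decide)
  · have hm := hideal _ (gz_le_borel D h hα hβ (by decide) heb) _ hya
    rw [lie_add] at hm
    refine ⟨_, bracket_gz' D hG h (0, 1) (1, 0) (1, 1) (by decide) (by decide) heb h1,
      bracket_ne D h (by decide) (by decide) (by decide) heb heb0 h1 hy1, _, ?_, hm⟩
    rw [lie_add]
    refine Submodule.add_mem _ ?_ ?_
    · exact bracket_GS D hG h {(0, 1)} {(0, 1)} _ ((mem_single D).1 heb) ((mem_single D).1 h2)
        (by decide) (by decide)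
    · exact bracket_GS D hG h {(0, 1)} _ _ ((mem_single D).1 heb) h3' (by decide) (by decide)

lemma not_abelian (hG : D.toRootSystemData.IsG2) (h : G2Pair D.toRootSystemData α β)
    (hα : α ∈ D.pos) (hβ : β ∈ D.pos) (a : Submodule ℂ L)
    (hideal : ∀ x ∈ D.borel, ∀ y ∈ a, ⁅x, y⁆ ∈ a) {u r : L} (hu : u ∈ gz D α β (1, 1))
    (hu0 : u ≠ 0) (hr : r ∈ GS D α β IS) (hur : u + r ∈ a) :
    ¬ ∀ x ∈ a, ∀ y ∈ a, ⁅x, y⁆ = 0 := by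
  intro hab
  obtain ⟨e, he, he0⟩ := exists_ne D h (p := (1, 0)) (by decide)
  have hz := hab _ hur _ (hideal _ (gz_le_borel D h hα hβ (by decide) he) _ hur)
  have k1 := bracket_gz' D hG h (1, 0) (1, 1) (2, 1) (by decide) (by decide) he hu
  have k2 : ⁅e, r⁆ ∈ GS D α β {(3, 1)} :=
    bracket_GS D hG h {(1, 0)} _ _ ((mem_single D).1 he) hr (by decide) (by decide)
  have k3 : ⁅u, ⁅e, r⁆⁆ = 0 := eq_zero_of_GS D <|
    bracket_GS D hG h {(1, 1)} _ _ ((mem_single D).1 hu) k2 (by decide) (by decide)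
  have k4 : ⁅r, ⁅e, r⁆⁆ = 0 := eq_zero_of_GS D <|
    bracket_GS D hG h _ _ _ hr k2 (by decide) (by decide)
  have k5 : ⁅r, ⁅e, u⁆⁆ = 0 := eq_zero_of_GS D <|
    bracket_GS D hG h _ _ _ hr ((mem_single D).1 k1) (by decide) (by decide)
  rw [lie_add, lie_add, add_lie, add_lie, k3, k4, k5, add_zero, add_zero, add_zero] at hz
  exact bracket_ne D h (by decide) (by decide) (by decide) hu hu0 k1
    (bracket_ne D h (by decide) (by decide) (by decide) he he0 hu hu0) hz

lemma cube_mul_eq_zero {A : Type*} [Ring A] [Algebra ℂ A] {X E : A} (hc : Commute X E)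
    (H : ∀ t : ℂ, (X + t • E) ^ 4 = 0) : X ^ 3 * E = 0 := by
  have hexp : ∀ t : ℂ, (X + t • E) ^ 4 = X ^ 4 + (4 * t) • (X ^ 3 * E)
      + (6 * t ^ 2) • (X ^ 2 * E ^ 2) + (4 * t ^ 3) • (X * E ^ 3) + t ^ 4 • E ^ 4 := by
    intro t
    have h4 : ∀ z : A, z * 4 = (4 : ℂ) • z := fun z => by
      rw [Algebra.smul_def, Algebra.commutes, map_ofNat]
    have h6 : ∀ z : A, z * 6 = (6 : ℂ) • z := fun z => by
      rw [Algebra.smul_def, Algebra.commutes, map_ofNat]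
    rw [(hc.smul_right t).add_pow]
    simp only [Finset.sum_range_succ, Finset.sum_range_zero, smul_pow, mul_smul_comm,
      smul_mul_assoc]
    simp [Nat.choose, h4, h6]
    module
  have e0 := H 0
  have e1 := H 1
  have e2 := H (-1)
  have e3 := H 2
  have e4 := H (-2)
  rw [hexp] at e0 e1 e2 e3 e4
  have : (48 : ℂ) • (X ^ 3 * E) = 0 := by
    linear_combination (norm := module) (8 : ℂ) • e1 - (8 : ℂ) • e2 - e3 + e4
  simpa using this

lemma not_spherical (hG : D.toRootSystemData.IsG2) (h : G2Pair D.toRootSystemData α β)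
    (hα : α ∈ D.pos) (hβ : β ∈ D.pos) (a : Submodule ℂ L)
    (hideal : ∀ x ∈ D.borel, ∀ y ∈ a, ⁅x, y⁆ ∈ a) {u r : L} (hu : u ∈ gz D α β (1, 1))
    (hu0 : u ≠ 0) (hr : r ∈ GS D α β IS) (hur : u + r ∈ a) :
    ¬ IsSphericalSubspace a := by
  intro hsph
  obtain ⟨e, he, he0⟩ := exists_ne D h (p := (1, 0)) (by decide)
  have heb := gz_le_borel D h hα hβ (by decide) he
  have hfa := hideal _ heb _ (hideal _ heb _ hur)
  have k1 := bracket_gz' D hG h (1, 0) (1, 1) (2, 1) (by decide) (by decide) he hu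
  have k1' := bracket_ne D h (by decide) (by decide) (by decide) he he0 hu hu0
  have k2 := bracket_gz' D hG h (1, 0) (2, 1) (3, 1) (by decide) (by decide) he k1
  have k2' := bracket_ne D h (by decide) (by decide) (by decide) he he0 k1 k1'
  have k3 : ⁅e, r⁆ ∈ GS D α β {(3, 1)} :=
    bracket_GS D hG h {(1, 0)} _ _ ((mem_single D).1 he) hr (by decide) (by decide)
  have k4 : ⁅e, ⁅e, r⁆⁆ = 0 := eq_zero_of_GS D <|
    bracket_GS D hG h {(1, 0)} _ _ ((mem_single D).1 he) k3 (by decide) (by decide)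
  rw [lie_add, lie_add, k4, add_zero] at hfa
  generalize ⁅e, ⁅e, u⁆⁆ = f at *
  have kill : ∀ z ∈ GS D α β {(3, 1)}, ⁅u + r, z⁆ = 0 := by
    intro z hz
    rw [add_lie, eq_zero_of_GS D (bracket_GS D hG h {(1, 1)} _ _ ((mem_single D).1 hu) hz
      (by decide) (by decide)), eq_zero_of_GS D (bracket_GS D hG h _ _ _ hr hz
      (by decide) (by decide)), add_zero]
  have hcomm : Commute (LieAlgebra.ad ℂ L (u + r)) (LieAlgebra.ad ℂ L f) := by
    ext y
    change ⁅u + r, ⁅f, y⁆⁆ = ⁅f, ⁅u + r, y⁆⁆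
    rw [leibniz_lie, kill f ((mem_single D).1 k2), zero_lie, zero_add]
  have hX := cube_mul_eq_zero hcomm (fun t => by
    rw [← map_smul, ← map_add]
    exact hsph _ (Submodule.add_mem _ hur (Submodule.smul_mem _ _ hfa)))
  obtain ⟨v, hv, hv0⟩ := exists_ne D h (p := (-3, -2)) (by decide)
  have w := bracket_gz' D hG h (3, 1) (-3, -2) (0, -1) (by decide) (by decide) k2 hv
  have w' := bracket_ne D h (by decide) (by decide) (by decide) k2 k2' hv hv0
  have hX2 : ⁅u + r, ⁅u + r, ⁅u + r, ⁅f, v⁆⁆⁆⁆ = 0 := by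
    have := LinearMap.congr_fun hX v
    simpa only [pow_succ, pow_zero, one_mul, Module.End.mul_apply, LieAlgebra.ad_apply,
      LinearMap.zero_apply] using this
  generalize ⁅f, v⁆ = w0 at *
  have m1 := bracket_gz' D hG h (1, 1) (0, -1) (1, 0) (by decide) (by decide) hu w
  have m1' := bracket_ne D h (by decide) (by decide) (by decide) hu hu0 w w'
  have m2 := bracket_gz' D hG h (1, 1) (1, 0) (2, 1) (by decide) (by decide) hu m1
  have m2' := bracket_ne D h (by decide) (by decide) (by decide) hu hu0 m1 m1'
  have m3' := bracket_ne D h (by decide) (by decide) (by decide) hu hu0 m2 m2'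
  have n1 : ⁅r, w0⁆ ∈ GS D α β {(3, 1)} :=
    bracket_GS D hG h _ _ _ hr ((mem_single D).1 w) (by decide) (by decide)
  have n2 : ⁅r, ⁅u, w0⁆⁆ ∈ GS D α β {(3, 1)} :=
    bracket_GS D hG h _ _ _ hr ((mem_single D).1 m1) (by decide) (by decide)
  have n3 : ⁅r, ⁅u, ⁅u, w0⁆⁆⁆ = 0 := eq_zero_of_GS D <|
    bracket_GS D hG h _ _ _ hr ((mem_single D).1 m2) (by decide) (by decide)
  rw [add_lie u r w0, lie_add (u + r) ⁅u, w0⁆, kill _ n1, add_zero, add_lie u r ⁅u, w0⁆,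
    lie_add (u + r) ⁅u, ⁅u, w0⁆⁆, kill _ n2, add_zero, add_lie, n3, add_zero] at hX2
  exact m3' hX2

end LiePart

end G2Aux

/-- Suppose `𝔤` is the complex simple Lie algebra of type `G₂`
and `𝔞 ⊆ 𝔟` is an ad-nilpotent ideal of the Borel subalgebra `𝔟` (i.e. an ideal
of `𝔟` contained in `𝔫`). Then `𝔞` is a spherical subspace of `𝔫` if and only if
`𝔞` is abelian. -/
theorem g2_ideal_spherical_iff_abelian
    {V : Type*} [NormedAddCommGroup V] [InnerProductSpace ℝ V]
    {L : Type*} [LieRing L] [LieAlgebra ℂ L]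
    (D : LieRootData V L)
    (hG2 : D.toRootSystemData.IsG2)
    (a : Submodule ℂ L) (ha : a ≤ D.nilrad)
    (hideal : ∀ x ∈ D.borel, ∀ y ∈ a, ⁅x, y⁆ ∈ a) :
    IsSphericalSubspace a ↔ ∀ x ∈ a, ∀ y ∈ a, ⁅x, y⁆ = 0 := by
  obtain ⟨α, β, h, hα, hβ⟩ := G2Aux.exists_pos_pair _ hG2
  by_cases hle : a ≤ G2Aux.GS D α β G2Aux.IS
  · exact ⟨fun _ x hx y hy => G2Aux.IS_abelian D hG2 h (hle hx) (hle hy),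
      fun _ x hx => G2Aux.IS_spherical D hG2 h (hle hx)⟩
  · obtain ⟨u, hu, hu0, r, hr, hur⟩ := G2Aux.exists_leading D hG2 h hα hβ a ha hideal hle
    exact ⟨fun hs => absurd hs (G2Aux.not_spherical D hG2 h hα hβ a hideal hu hu0 hr hur),
      fun hs => absurd hs (G2Aux.not_abelian D hG2 h hα hβ a hideal hu hu0 hr hur)⟩
end
end
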